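/- arXiv:1607.00278 — 2 statements merged into one kernel-verified Lean document; each statement's English description precedes it below -/
import Mathlib

section
/- Let K be a finite simple graph, let w be a vertex of K, and let S, T be a partition of the remaining vertices of K such that K has no edge between S and T. Let G be the subgraph of K induced on S ∪ {w} and let H be the subgraph of K induced on T ∪ {w}. If G has an exposed outside-obstacle representation, and H has an exposed outside-obstacle representation in which the point of w is an extreme point of the point set, then K has an exposed outside-obstacle representation. -/
noncomputable section

/-- The plane ℝ². -/
abbrev Plane : Type := EuclideanSpace ℝ (Fin 2)

/-- A point set is in general position if no three of its points are collinear. -/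
def InGenPos (P : Set Plane) : Prop :=
  ∀ p ∈ P, ∀ q ∈ P, ∀ r ∈ P, p ≠ q → p ≠ r → q ≠ r →
    ¬ Collinear ℝ ({p, q, r} : Set Plane)

/-- The union of the closed segments corresponding to the edges of `G`
in the straight-line drawing given by `f`. -/
def edgeUnion {V : Type} (G : SimpleGraph V) (f : V → Plane) : Set Plane :=
  ⋃ (u : V) (v : V) (_ : G.Adj u v), segment ℝ (f u) (f v)

/-- The unbounded connected component of the complement of the drawing. -/
def outsideRegion {V : Type} (G : SimpleGraph V) (f : V → Plane) : Set Plane :=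
  {p | p ∈ (edgeUnion G f)ᶜ ∧
       ¬ Bornology.IsBounded (connectedComponentIn (edgeUnion G f)ᶜ p)}

/-- `(f, C)` is a single-obstacle representation of `G`. -/
def IsObstacleRep {V : Type} (G : SimpleGraph V) (f : V → Plane) (C : Set Plane) : Prop :=
  Function.Injective f ∧ InGenPos (Set.range f) ∧
  IsOpen C ∧ IsConnected C ∧ Disjoint C (Set.range f) ∧
  ∀ u v : V, u ≠ v → (G.Adj u v ↔ Disjoint (segment ℝ (f u) (f v)) C)

/-- An outside-obstacle representation: the obstacle lies in the unbounded component. -/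
def IsOutsideObstacleRep {V : Type} (G : SimpleGraph V) (f : V → Plane) (C : Set Plane) : Prop :=
  IsObstacleRep G f C ∧ C ⊆ outsideRegion G f

/-- An inside-obstacle representation: the obstacle avoids the unbounded component. -/
def IsInsideObstacleRep {V : Type} (G : SimpleGraph V) (f : V → Plane) (C : Set Plane) : Prop :=
  IsObstacleRep G f C ∧ Disjoint C (outsideRegion G f)

/-- An exposed outside-obstacle representation: every vertex lies on the boundary of
the unbounded component. -/
def IsExposedOutsideObstacleRep {V : Type} (G : SimpleGraph V) (f : V → Plane)
    (C : Set Plane) : Prop :=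
  IsOutsideObstacleRep G f C ∧ ∀ v : V, f v ∈ closure (outsideRegion G f)

/-- `p` is an extreme point ("on the convex hull") of the point set `P`. -/
def IsExtremePt (p : Plane) (P : Set Plane) : Prop :=
  p ∉ convexHull ℝ (P \ {p})

/-- `S` has at least `n` connected components. -/
def AtLeastNComponents (S : Set Plane) (n : ℕ) : Prop :=
  ∃ p : Fin n → Plane, (∀ i, p i ∈ S) ∧
    ∀ i j : Fin n, i ≠ j →
      connectedComponentIn S (p i) ≠ connectedComponentIn S (p j)

/-- `S` has exactly `n` connected components. -/
def ExactlyNComponents (S : Set Plane) (n : ℕ) : Prop :=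
  ∃ p : Fin n → Plane, (∀ i, p i ∈ S) ∧
    (∀ i j : Fin n, i ≠ j →
      connectedComponentIn S (p i) ≠ connectedComponentIn S (p j)) ∧
    ∀ q ∈ S, ∃ i : Fin n, connectedComponentIn S q = connectedComponentIn S (p i)

/-- The convex hulls of `A` and `B` are at least `t`-crossing. -/
def AtLeastCrossing (A B : Set Plane) (t : ℕ) : Prop :=
  ((convexHull ℝ A) ∩ (convexHull ℝ B)).Nonempty ∧
    AtLeastNComponents ((convexHull ℝ A) \ (convexHull ℝ B)) (t + 1)

/-- The convex hulls of `A` and `B` are exactly `t`-crossing. -/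
def ExactlyCrossing (A B : Set Plane) (t : ℕ) : Prop :=
  ((convexHull ℝ A) ∩ (convexHull ℝ B)).Nonempty ∧
    ExactlyNComponents ((convexHull ℝ A) \ (convexHull ℝ B)) (t + 1)


open Set Filter Topology

/-- Removing a relatively closed set `D`, surrounded by `Q`, does not disconnect. -/
lemma preconn_diff {O Q D : Set Plane} (hO : IsPreconnected O) (hOo : IsOpen O)
    (hQo : IsOpen Q) (hQO : Q ⊆ O) (hD : IsClosed D) (hDQ : D ∩ O ⊆ Q)
    (hQD : IsPreconnected (Q \ D)) : IsPreconnected (O \ D) := by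
  rcases (Q \ D).eq_empty_or_nonempty with he | ⟨q, hq⟩
  · -- then `Q ⊆ D`, so `D ∩ O = Q` is clopen in `O`
    have h1 : O ⊆ Q ∪ Dᶜ := by
      intro x hx
      by_cases hxD : x ∈ D
      · exact Or.inl (hDQ ⟨hxD, hx⟩)
      · exact Or.inr hxD
    have h2 : Disjoint Q Dᶜ := by
      rw [Set.disjoint_left]
      intro x hx hxD
      have : x ∈ Q \ D := ⟨hx, hxD⟩
      rw [he] at this
      exact this
    rcases (isPreconnected_iff_subset_of_disjoint.1 hO) Q Dᶜ hQo hD.isOpen_compl h1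
      (by rw [h2.inter_eq, inter_empty]) with h | h
    · have : O \ D = ∅ := by
        rw [Set.eq_empty_iff_forall_notMem]
        rintro x ⟨hx, hxD⟩
        exact Set.disjoint_left.1 h2 (h hx) hxD
      rw [this]
      exact isPreconnected_empty
    · have : O \ D = O := by
        ext x
        exact ⟨fun h => h.1, fun hx => ⟨hx, h hx⟩⟩
      rwa [this]
  · have key : ∀ A B : Set Plane, IsOpen A → IsOpen B → O \ D ⊆ A ∪ B →
        (O \ D) ∩ (A ∩ B) = ∅ → Q \ D ⊆ A → O \ D ⊆ A := by
      intro A B hA hB hAB hdis hQA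
      have h1 : O ⊆ (A ∩ (O \ D) ∪ Q) ∪ (B ∩ (O \ D)) := by
        intro x hx
        by_cases hxD : x ∈ D
        · exact Or.inl (Or.inr (hDQ ⟨hxD, hx⟩))
        · rcases hAB ⟨hx, hxD⟩ with h | h
          · exact Or.inl (Or.inl ⟨h, hx, hxD⟩)
          · exact Or.inr ⟨h, hx, hxD⟩
      have hOD : IsOpen (O \ D) := hOo.sdiff hD
      have h2 : O ∩ ((A ∩ (O \ D) ∪ Q) ∩ (B ∩ (O \ D))) = ∅ := by
        rw [Set.eq_empty_iff_forall_notMem]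
        rintro x ⟨_, h | h, hb, hx⟩
        · rw [Set.eq_empty_iff_forall_notMem] at hdis
          exact hdis x ⟨hx, h.1, hb⟩
        · rw [Set.eq_empty_iff_forall_notMem] at hdis
          exact hdis x ⟨hx, hQA ⟨h, hx.2⟩, hb⟩
      rcases (isPreconnected_iff_subset_of_disjoint.1 hO) _ _ ((hA.inter hOD).union hQo)
        (hB.inter hOD) h1 h2 with h | h
      · intro x hx
        rcases h hx.1 with h | h
        · exact h.1
        · exact hQA ⟨h, hx.2⟩
      · exfalso
        have := h (hQO hq.1)
        rw [Set.eq_empty_iff_forall_notMem] at hdis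
        exact hdis q ⟨this.2, hQA hq, this.1⟩
    rw [isPreconnected_iff_subset_of_disjoint]
    intro A B hA hB hAB hdis
    have hsub : Q \ D ⊆ O \ D := sdiff_subset_sdiff_left hQO
    rcases (isPreconnected_iff_subset_of_disjoint.1 hQD) A B hA hB (hsub.trans hAB)
      (by
        rw [← Set.subset_empty_iff, ← hdis]
        exact inter_subset_inter_left _ hsub) with h | h
    · exact Or.inl (key A B hA hB hAB hdis h)
    · exact Or.inr (key B A hB hA (by rwa [union_comm]) (by rwa [inter_comm B A]) h)

lemma one_lt_rank_plane : 1 < Module.rank ℝ Plane := by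
  rw [← Module.finrank_eq_rank, finrank_euclideanSpace]
  norm_num

lemma preconn_punctured_ball (c : Plane) {r : ℝ} (hr : 0 < r) :
    IsPreconnected (Metric.ball c r \ {c}) := by
  have h := (isConnected_compl_singleton_of_one_lt_rank one_lt_rank_plane (0 : Plane)).isPreconnected
  have h2 := h.image (OpenPartialHomeomorph.univBall c r)
    (OpenPartialHomeomorph.continuous_univBall c r).continuousOn
  convert h2 using 1
  ext x
  constructor
  · rintro ⟨hx, hxc⟩
    have hx' : x ∈ (OpenPartialHomeomorph.univBall c r).target := by
      rwa [OpenPartialHomeomorph.univBall_target c hr]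
    refine ⟨(OpenPartialHomeomorph.univBall c r).symm x, ?_,
      (OpenPartialHomeomorph.univBall c r).right_inv hx'⟩
    intro h0
    apply hxc
    have := (OpenPartialHomeomorph.univBall c r).right_inv hx'
    rw [mem_singleton_iff.1 h0, OpenPartialHomeomorph.univBall_apply_zero] at this
    exact this.symm
  · rintro ⟨y, hy, rfl⟩
    have hys : y ∈ (OpenPartialHomeomorph.univBall c r).source := by simp
    refine ⟨?_, ?_⟩
    · rw [← OpenPartialHomeomorph.univBall_target c hr]
      exact (OpenPartialHomeomorph.univBall c r).map_source hys
    · intro h0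
      apply hy
      have := (OpenPartialHomeomorph.univBall c r).injOn hys
        (by simp : (0 : Plane) ∈ (OpenPartialHomeomorph.univBall c r).source)
      apply this
      rw [OpenPartialHomeomorph.univBall_apply_zero]
      exact h0

lemma preconn_diff_point {O : Set Plane} (hO : IsPreconnected O) (hOo : IsOpen O) (c : Plane) :
    IsPreconnected (O \ {c}) := by
  by_cases hc : c ∈ O
  · obtain ⟨r, hr, hball⟩ := Metric.isOpen_iff.1 hOo c hc
    refine preconn_diff hO hOo Metric.isOpen_ball hball isClosed_singleton ?_
      (preconn_punctured_ball c hr)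
    rintro x ⟨hx, _⟩
    rw [mem_singleton_iff.1 hx]
    exact Metric.mem_ball_self hr
  · rwa [sdiff_singleton_eq_self hc]

lemma preconn_diff_finite {O F : Set Plane} (hO : IsPreconnected O) (hOo : IsOpen O)
    (hF : F.Finite) : IsPreconnected (O \ F) := by
  induction F, hF using Set.Finite.induction_on with
  | empty => simpa using hO
  | insert _ hF ih =>
    rename_i a s _
    have : O \ insert a s = (O \ s) \ {a} := by
      ext x; simp; tauto
    rw [this]
    exact preconn_diff_point ih (hOo.sdiff hF.isClosed) a

lemma preconn_compl_closedBall {R : ℝ} (hR : 0 ≤ R) :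
    IsPreconnected (Metric.closedBall (0 : Plane) R)ᶜ := by
  have h := (isPreconnected_Ioi (a := R)).prod
    (isPreconnected_sphere one_lt_rank_plane (0 : Plane) 1)
  have h2 := h.image (fun p : ℝ × Plane => p.1 • p.2) (by fun_prop)
  convert h2 using 1
  ext x
  simp only [mem_compl_iff, Metric.mem_closedBall, dist_zero_right, not_le, mem_image, mem_prod,
    mem_Ioi, mem_sphere_iff_norm, sub_zero, Prod.exists]
  constructor
  · intro hx
    have : ‖x‖ ≠ 0 := by linarith
    refine ⟨‖x‖, ‖x‖⁻¹ • x, ⟨hx, ?_⟩, ?_⟩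
    · rw [norm_smul, norm_inv, norm_norm, inv_mul_cancel₀ this]
    · rw [smul_smul, mul_inv_cancel₀ this, one_smul]
  · rintro ⟨a, b, ⟨ha, hb⟩, rfl⟩
    rw [norm_smul, hb, mul_one, Real.norm_eq_abs]
    exact lt_of_lt_of_le ha (le_abs_self a)

lemma unbounded_compl {E : Set Plane} (hE : Bornology.IsBounded E) :
    ¬ Bornology.IsBounded Eᶜ := by
  intro h
  have := hE.union h
  rw [union_compl_self] at this
  exact NormedSpace.unbounded_univ ℝ Plane this

/-- Union of the unbounded components of the complement. -/
def outSet (E : Set Plane) : Set Plane :=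
  {p | p ∈ Eᶜ ∧ ¬ Bornology.IsBounded (connectedComponentIn Eᶜ p)}

lemma mem_outSet_of {E X : Set Plane} {p : Plane} (hX : IsPreconnected X) (hXE : X ⊆ Eᶜ)
    (hXb : ¬ Bornology.IsBounded X) (hp : p ∈ X) : p ∈ outSet E :=
  ⟨hXE hp, fun h => hXb (h.subset (hX.subset_connectedComponentIn hp hXE))⟩

lemma outSet_subset {E : Set Plane} : outSet E ⊆ Eᶜ := fun _ h => h.1

lemma outSet_absorb {E X : Set Plane} {p : Plane} (hX : IsPreconnected X) (hXE : X ⊆ Eᶜ)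
    (hp : p ∈ X) (hpE : p ∈ outSet E) : X ⊆ outSet E := by
  intro q hq
  refine ⟨hXE hq, ?_⟩
  have := connectedComponentIn_eq (hX.subset_connectedComponentIn hp hXE hq)
  rw [← this]
  exact hpE.2

lemma outSet_isOpen {E : Set Plane} (hE : IsClosed E) : IsOpen (outSet E) := by
  rw [isOpen_iff_mem_nhds]
  intro p hp
  refine mem_of_superset (hE.isOpen_compl.connectedComponentIn.mem_nhds
    (mem_connectedComponentIn hp.1)) ?_
  exact outSet_absorb isPreconnected_connectedComponentIn (connectedComponentIn_subset _ _)
    (mem_connectedComponentIn hp.1) hp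

lemma inSet_isOpen {E : Set Plane} (hE : IsClosed E) : IsOpen (Eᶜ \ outSet E) := by
  rw [isOpen_iff_mem_nhds]
  intro p hp
  refine mem_of_superset (hE.isOpen_compl.connectedComponentIn.mem_nhds
    (mem_connectedComponentIn hp.1)) ?_
  intro q hq
  refine ⟨connectedComponentIn_subset _ _ hq, fun h => hp.2 ?_⟩
  exact outSet_absorb isPreconnected_connectedComponentIn (connectedComponentIn_subset _ _)
    hq h (mem_connectedComponentIn hp.1)

lemma outSet_preconn {E : Set Plane} (hE : Bornology.IsBounded E) :
    IsPreconnected (outSet E) ∧ ¬ Bornology.IsBounded (outSet E) := by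
  obtain ⟨R, hR0, hR⟩ : ∃ R : ℝ, 0 ≤ R ∧ E ⊆ Metric.closedBall 0 R := by
    obtain ⟨R, hR⟩ := hE.subset_closedBall (0 : Plane)
    exact ⟨max R 0, le_max_right _ _, hR.trans (Metric.closedBall_subset_closedBall (le_max_left _ _))⟩
  have hB := preconn_compl_closedBall hR0
  have hBu : ¬ Bornology.IsBounded (Metric.closedBall (0 : Plane) R)ᶜ :=
    unbounded_compl Metric.isBounded_closedBall
  have hBE : (Metric.closedBall (0 : Plane) R)ᶜ ⊆ Eᶜ := compl_subset_compl.2 hR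
  have hBsub : (Metric.closedBall (0 : Plane) R)ᶜ ⊆ outSet E :=
    fun p hp => mem_outSet_of hB hBE hBu hp
  refine ⟨?_, fun h => hBu (h.subset hBsub)⟩
  obtain ⟨b, hb⟩ : (Metric.closedBall (0 : Plane) R)ᶜ.Nonempty := by
    rw [nonempty_iff_ne_empty]
    intro h
    rw [h] at hBu
    exact hBu Bornology.isBounded_empty
  have : outSet E = connectedComponentIn Eᶜ b := by
    apply Subset.antisymm
    · intro p hp
      have : ∃ q ∈ connectedComponentIn Eᶜ p, q ∈ (Metric.closedBall (0 : Plane) R)ᶜ := by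
        by_contra! h
        apply hp.2
        exact Metric.isBounded_closedBall.subset fun q hq => not_not.1 (h q hq)
      obtain ⟨q, hq1, hq2⟩ := this
      have h1 := connectedComponentIn_eq hq1
      have h2 := connectedComponentIn_eq (hB.subset_connectedComponentIn hb hBE hq2)
      rw [h2, ← h1]
      exact mem_connectedComponentIn hp.1
    · exact outSet_absorb isPreconnected_connectedComponentIn (connectedComponentIn_subset _ _)
        (mem_connectedComponentIn (hBE hb)) (hBsub hb)
  rw [this]
  exact isPreconnected_connectedComponentIn

/-- On a nondegenerate segment one can perturb to avoid a finite set. -/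
lemma segment_avoid {a b p : Plane} {U F : Set Plane} (hab : a ≠ b) (hp : p ∈ segment ℝ a b)
    (hU : IsOpen U) (hpU : p ∈ U) (hF : F.Finite) : ∃ q ∈ segment ℝ a b, q ∈ U ∧ q ∉ F := by
  by_cases hpF : p ∈ F
  · have hpre : IsPreconnected (segment ℝ a b) := (convex_segment a b).isPreconnected
    have hnt : (segment ℝ a b).Nontrivial :=
      ⟨a, left_mem_segment _ _ _, b, right_mem_segment _ _ _, hab⟩
    have hacc := hpre.preperfect_of_nontrivial hnt p hp
    rw [accPt_iff_nhds] at hacc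
    have hN : U \ (F \ {p}) ∈ 𝓝 p :=
      (hU.sdiff (hF.subset sdiff_subset).isClosed).mem_nhds ⟨hpU, fun h => h.2 rfl⟩
    obtain ⟨q, ⟨hq1, hq2⟩, hqp⟩ := hacc _ hN
    exact ⟨q, hq2, hq1.1, fun h => hq1.2 ⟨h, hqp⟩⟩
  · exact ⟨p, hp, hpU, hpF⟩

/-- A reformulation of having an exposed outside-obstacle representation on `f`. -/
structure Good {V : Type} (G : SimpleGraph V) (f : V → Plane) : Prop where
  inj : Function.Injective f
  gen : InGenPos (range f)
  non : ∀ u v : V, u ≠ v → ¬ G.Adj u v → (segment ℝ (f u) (f v) ∩ outSet (edgeUnion G f)).Nonempty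
  exposed : ∀ v, f v ∈ closure (outSet (edgeUnion G f))

lemma edgeUnion_isCompact {V : Type} [Finite V] (G : SimpleGraph V) (f : V → Plane) :
    IsCompact (edgeUnion G f) := by
  unfold edgeUnion
  refine isCompact_iUnion fun u => isCompact_iUnion fun v => isCompact_iUnion fun _ => ?_
  rw [segment_eq_image_lineMap]
  exact isCompact_Icc.image AffineMap.lineMap_continuous

lemma segment_subset_edgeUnion {V : Type} (G : SimpleGraph V) (f : V → Plane) {u v : V}
    (h : G.Adj u v) : segment ℝ (f u) (f v) ⊆ edgeUnion G f := by
  intro x hx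
  simp only [edgeUnion, mem_iUnion]
  exact ⟨u, v, h, hx⟩

lemma mem_edgeUnion {V : Type} (G : SimpleGraph V) (f : V → Plane) {x : Plane} :
    x ∈ edgeUnion G f ↔ ∃ u v, G.Adj u v ∧ x ∈ segment ℝ (f u) (f v) := by
  simp only [edgeUnion, mem_iUnion, exists_prop]

lemma Good.of_rep {V : Type} {G : SimpleGraph V} {f : V → Plane} {C : Set Plane}
    (h : IsExposedOutsideObstacleRep G f C) : Good G f := by
  obtain ⟨⟨⟨hinj, hgen, hCo, hCc, hCd, hadj⟩, hout⟩, hexp⟩ := h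
  refine ⟨hinj, hgen, ?_, hexp⟩
  intro u v huv hna
  rw [hadj u v huv, Set.not_disjoint_iff] at hna
  obtain ⟨x, hx, hxC⟩ := hna
  exact ⟨x, hx, hout hxC⟩

lemma Good.to_rep {V : Type} [Finite V] {G : SimpleGraph V} {f : V → Plane} (h : Good G f) :
    ∃ C, IsExposedOutsideObstacleRep G f C := by
  have hE := edgeUnion_isCompact G f
  have hO := outSet_isOpen hE.isClosed
  obtain ⟨hpre, hunb⟩ := outSet_preconn hE.isBounded
  have hF : (range f).Finite := finite_range f
  refine ⟨outSet (edgeUnion G f) \ range f, ⟨⟨h.inj, h.gen, hO.sdiff hF.isClosed, ⟨?_,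
    preconn_diff_finite hpre hO hF⟩, disjoint_sdiff_left, ?_⟩, fun x hx => hx.1⟩, h.exposed⟩
  · rw [nonempty_iff_ne_empty]
    intro he
    rw [sdiff_eq_empty] at he
    exact hunb (hF.isBounded.subset he)
  · intro u v huv
    constructor
    · intro hadj
      rw [Set.disjoint_left]
      intro x hx hx2
      exact hx2.1.1 (segment_subset_edgeUnion G f hadj hx)
    · intro hd
      by_contra hna
      obtain ⟨x, hx, hxU⟩ := h.non u v huv hna
      obtain ⟨q, hq, hqU, hqF⟩ := segment_avoid (h.inj.ne huv) hx hO hxU hF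
      exact Set.disjoint_left.1 hd hq ⟨hqU, hqF⟩

lemma isBounded_image_homeo (φ : Plane ≃ₜ Plane) {X : Set Plane} (hX : Bornology.IsBounded X) :
    Bornology.IsBounded (φ '' X) := by
  have : IsCompact (closure X) := hX.isCompact_closure
  exact (this.image φ.continuous).isBounded.subset (image_mono subset_closure)

lemma outSet_image_subset (φ : Plane ≃ₜ Plane) (E : Set Plane) :
    φ '' outSet E ⊆ outSet (φ '' E) := by
  rintro _ ⟨p, hp, rfl⟩
  have h1 : φ '' connectedComponentIn Eᶜ p ⊆ (φ '' E)ᶜ := by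
    rw [← image_compl_eq φ.bijective]
    exact image_mono (connectedComponentIn_subset _ _)
  refine mem_outSet_of (isPreconnected_connectedComponentIn.image φ φ.continuous.continuousOn) h1 ?_
    (mem_image_of_mem _ (mem_connectedComponentIn hp.1))
  intro hb
  apply hp.2
  have := isBounded_image_homeo φ.symm hb
  rwa [← image_comp, φ.symm_comp_self, image_id] at this

lemma edgeUnion_image {V : Type} (G : SimpleGraph V) (f : V → Plane) (φ : Plane ≃ᵃ[ℝ] Plane) :
    edgeUnion G (φ ∘ f) = φ '' edgeUnion G f := by
  simp only [edgeUnion, image_iUnion, Function.comp]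
  congr! with u v _
  exact (image_segment ℝ φ.toAffineMap (f u) (f v)).symm

lemma outSet_edge_image {V : Type} (G : SimpleGraph V) (f : V → Plane) (φ : Plane ≃ᵃ[ℝ] Plane) :
    φ '' outSet (edgeUnion G f) ⊆ outSet (edgeUnion G (φ ∘ f)) := by
  rw [edgeUnion_image]
  exact outSet_image_subset (AffineEquiv.toContinuousAffineEquiv φ).toHomeomorph _

/-- twice the signed area -/
def cross (p q r : Plane) : ℝ := (q 0 - p 0) * (r 1 - p 1) - (q 1 - p 1) * (r 0 - p 0)

lemma collinear_iff_cross (p q r : Plane) : Collinear ℝ ({p, q, r} : Set Plane) ↔ cross p q r = 0 := by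
  rw [collinear_iff_of_mem (p₀ := p) (by simp)]
  constructor
  · rintro ⟨v, hv⟩
    obtain ⟨a, ha⟩ := hv q (by simp)
    obtain ⟨b, hb⟩ := hv r (by simp)
    rw [ha, hb]
    simp [cross]
    ring
  · intro h
    by_cases hpq : q = p
    · refine ⟨r - p, ?_⟩
      simp only [mem_insert_iff, mem_singleton_iff, forall_eq_or_imp, forall_eq]
      exact ⟨⟨0, by simp⟩, ⟨0, by simp [hpq]⟩, ⟨1, by simp⟩⟩
    · refine ⟨q - p, ?_⟩
      simp only [mem_insert_iff, mem_singleton_iff, forall_eq_or_imp, forall_eq]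
      refine ⟨⟨0, by simp⟩, ⟨1, by simp⟩, ?_⟩
      unfold cross at h
      by_cases h0 : q 0 - p 0 = 0
      · have h1 : q 1 - p 1 ≠ 0 := by
          intro h1
          apply hpq
          ext i
          fin_cases i
          · exact sub_eq_zero.1 h0
          · exact sub_eq_zero.1 h1
        refine ⟨(r 1 - p 1) / (q 1 - p 1), ?_⟩
        ext i
        fin_cases i
        · have : r 0 - p 0 = 0 := by
            rw [h0] at h
            simpa [h1] using h
          simp [h0]; linarith
        · simp; field_simp; ring
      · refine ⟨(r 0 - p 0) / (q 0 - p 0), ?_⟩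
        ext i
        fin_cases i
        · simp; field_simp; ring
        · simp; field_simp; linarith

lemma Good.map {V : Type} {G : SimpleGraph V} {f : V → Plane} (h : Good G f)
    (φ : Plane ≃ᵃ[ℝ] Plane) : Good G (φ ∘ f) := by
  refine ⟨φ.injective.comp h.inj, ?_, ?_, ?_⟩
  · rintro _ ⟨u, rfl⟩ _ ⟨v, rfl⟩ _ ⟨x, rfl⟩ h1 h2 h3 hc
    have hne : ∀ a b, (φ ∘ f) a ≠ (φ ∘ f) b → f a ≠ f b := fun a b hab he => hab (congrArg φ he)
    refine h.gen (f u) ⟨u, rfl⟩ (f v) ⟨v, rfl⟩ (f x) ⟨x, rfl⟩ (hne _ _ h1) (hne _ _ h2)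
      (hne _ _ h3) ?_
    rw [collinear_iff_exists_forall_eq_smul_vadd] at hc ⊢
    obtain ⟨p₀, d, hd⟩ := hc
    refine ⟨φ.symm p₀, φ.symm.linear d, ?_⟩
    simp only [mem_insert_iff, mem_singleton_iff, forall_eq_or_imp, forall_eq] at hd ⊢
    have key : ∀ a, (∃ r : ℝ, (φ ∘ f) a = r • d +ᵥ p₀) →
        ∃ r : ℝ, f a = r • φ.symm.linear d +ᵥ φ.symm p₀ := by
      rintro a ⟨r, hr⟩
      refine ⟨r, ?_⟩
      have h4 : f a = φ.symm (φ (f a)) := (φ.symm_apply_apply _).symm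
      rw [h4]
      change φ (f a) = _ at hr
      rw [hr, AffineEquiv.map_vadd, map_smul]
    exact ⟨key _ hd.1, key _ hd.2.1, key _ hd.2.2⟩
  · intro u v huv hna
    obtain ⟨x, hx, hxU⟩ := h.non u v huv hna
    refine ⟨φ x, ?_, outSet_edge_image G f φ (mem_image_of_mem _ hxU)⟩
    have := mem_image_of_mem φ hx
    have h2 := image_segment ℝ φ.toAffineMap (f u) (f v)
    exact h2 ▸ this
  · intro v
    refine closure_mono (outSet_edge_image G f φ) ?_
    exact map_mem_closure (f := φ) (AffineEquiv.toContinuousAffineEquiv φ).toHomeomorph.continuous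
      (h.exposed v) (mapsTo_image _ _)

/-- The open triangle (sector) at the origin. -/
def QQ : Set Plane := {p | 0 < p 0 ∧ p 0 < 2 ∧ -p 0 < p 1 ∧ p 1 < p 0}

/-- The thin closed triangle at the origin. -/
def DD (ε : ℝ) : Set Plane := {p | 0 ≤ p 0 ∧ p 0 ≤ ε ∧ -p 0 ≤ 2 * p 1 ∧ 2 * p 1 ≤ p 0}

@[fun_prop]
lemma cont_coord (i : Fin 2) : Continuous (fun p : Plane => p i) := by fun_prop

lemma QQ_open : IsOpen QQ := by
  have h : QQ = {p : Plane | 0 < p 0} ∩ ({p : Plane | p 0 < 2} ∩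
      ({p : Plane | -p 0 < p 1} ∩ {p : Plane | p 1 < p 0})) := rfl
  rw [h]
  refine IsOpen.inter ?_ (IsOpen.inter ?_ (IsOpen.inter ?_ ?_)) <;>
    exact isOpen_lt (by fun_prop) (by fun_prop)

lemma DD_closed (ε : ℝ) : IsClosed (DD ε) := by
  have h : DD ε = {p : Plane | 0 ≤ p 0} ∩ ({p : Plane | p 0 ≤ ε} ∩
      ({p : Plane | -p 0 ≤ 2 * p 1} ∩ {p : Plane | 2 * p 1 ≤ p 0})) := rfl
  rw [h]
  refine IsClosed.inter ?_ (IsClosed.inter ?_ (IsClosed.inter ?_ ?_)) <;>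
    exact isClosed_le (by fun_prop) (by fun_prop)

lemma plane_ext {p q : Plane} (h0 : p 0 = q 0) (h1 : p 1 = q 1) : p = q := by
  ext i
  fin_cases i
  · exact h0
  · exact h1

lemma QQ_convex : Convex ℝ QQ := by
  rintro p ⟨h1, h2, h3, h4⟩ q ⟨k1, k2, k3, k4⟩ a b ha hb hab
  simp only [QQ, mem_ofPred_eq, PiLp.add_apply, PiLp.smul_apply, smul_eq_mul]
  obtain rfl : b = 1 - a := by linarith
  rcases eq_or_lt_of_le ha with rfl | ha
  · simp; exact ⟨k1, k2, k3, k4⟩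
  · refine ⟨by nlinarith, by nlinarith, by nlinarith, by nlinarith⟩

lemma DD_convex (ε : ℝ) : Convex ℝ (DD ε) := by
  rintro p ⟨h1, h2, h3, h4⟩ q ⟨k1, k2, k3, k4⟩ a b ha hb hab
  simp only [DD, mem_ofPred_eq, PiLp.add_apply, PiLp.smul_apply, smul_eq_mul]
  obtain rfl : b = 1 - a := by linarith
  refine ⟨by nlinarith, by nlinarith, by nlinarith, by nlinarith⟩

lemma DD_norm {ε : ℝ} {p : Plane} (h : p ∈ DD ε) : ‖p‖ ≤ 2 * ε := by
  obtain ⟨h1, h2, h3, h4⟩ := h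
  rw [EuclideanSpace.norm_eq, Fin.sum_univ_two, Real.sqrt_le_left (by linarith)]
  simp only [Real.norm_eq_abs, sq_abs]
  nlinarith

lemma DD_bounded (ε : ℝ) : Bornology.IsBounded (DD ε) := by
  refine (Metric.isBounded_closedBall (x := (0 : Plane)) (r := 2 * ε)).subset ?_
  intro p hp
  rw [Metric.mem_closedBall, dist_zero_right]
  exact DD_norm hp

lemma DD_subset_QQ {ε : ℝ} (hε : ε < 2) {p : Plane} (hp : p ∈ DD ε) (h0 : p ≠ 0) : p ∈ QQ := by
  obtain ⟨h1, h2, h3, h4⟩ := hp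
  have : 0 < p 0 := by
    rcases eq_or_lt_of_le h1 with h | h
    · exact absurd (plane_ext (q := 0) (by simp [← h]) (by simp; linarith)) h0
    · exact h
  exact ⟨this, by linarith, by linarith, by linarith⟩

lemma zero_mem_DD {ε : ℝ} (hε : 0 < ε) : (0 : Plane) ∈ DD ε := by
  simp [DD, hε.le]

lemma zero_notMem_QQ : (0 : Plane) ∉ QQ := by
  simp [QQ]

lemma convex_aux (a b c : ℝ) : Convex ℝ {p : Plane | a * p 0 + b * p 1 < c} := by
  intro p hp q hq s t hs ht hst
  simp only [mem_ofPred_eq, PiLp.add_apply, PiLp.smul_apply, smul_eq_mul] at *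
  obtain rfl : t = 1 - s := by linarith
  rcases eq_or_lt_of_le hs with rfl | hs
  · simpa using hq
  · nlinarith

lemma QQ_diff_DD_preconn {ε : ℝ} (h0 : 0 < ε) (hε : ε < 2) : IsPreconnected (QQ \ DD ε) := by
  set A : Set Plane := QQ ∩ {p | (-1) * p 0 + 0 * p 1 < -ε}
  set B : Set Plane := QQ ∩ {p | 1 * p 0 + (-2) * p 1 < 0}
  set C : Set Plane := QQ ∩ {p | 1 * p 0 + 2 * p 1 < 0}
  have hA : IsPreconnected A := (QQ_convex.inter (convex_aux _ _ _)).isPreconnected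
  have hB : IsPreconnected B := (QQ_convex.inter (convex_aux _ _ _)).isPreconnected
  have hC : IsPreconnected C := (QQ_convex.inter (convex_aux _ _ _)).isPreconnected
  have hAB : (A ∩ B).Nonempty := by
    refine ⟨!₂[(ε + 2) / 2, 3 * (ε + 2) / 8], ⟨?_, ?_⟩, ⟨?_, ?_⟩⟩ <;> simp [QQ] <;>
      first | linarith | (refine ⟨?_, ?_, ?_, ?_⟩ <;> linarith)
  have hAC : ((A ∪ B) ∩ C).Nonempty := by
    refine ⟨!₂[(ε + 2) / 2, -(3 * (ε + 2) / 8)], Or.inl ⟨?_, ?_⟩, ⟨?_, ?_⟩⟩ <;> simp [QQ] <;>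
      first | linarith | (refine ⟨?_, ?_, ?_, ?_⟩ <;> linarith)
  have := (hA.union' hAB hB).union' hAC hC
  convert this using 1
  ext p
  simp only [A, B, C, QQ, DD, Set.mem_sdiff, mem_union, mem_inter_iff, mem_ofPred_eq, not_and_or, not_le]
  constructor
  · rintro ⟨h, h1 | h1 | h1 | h1⟩
    · linarith
    · exact Or.inl (Or.inl ⟨h, by linarith⟩)
    · exact Or.inr ⟨h, by linarith⟩
    · exact Or.inl (Or.inr ⟨h, by linarith⟩)
  · rintro ((⟨h, h1⟩ | ⟨h, h1⟩) | ⟨h, h1⟩)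
    · exact ⟨h, Or.inr (Or.inl (by linarith))⟩
    · exact ⟨h, Or.inr (Or.inr (Or.inr (by linarith)))⟩
    · exact ⟨h, Or.inr (Or.inr (Or.inl (by linarith)))⟩

lemma out_union_A {E F : Set Plane} {ε : ℝ} (h0 : 0 < ε) (hε : ε < 2) (hE : IsCompact E)
    (hFD : F ⊆ DD ε) (hQ : QQ ⊆ outSet E) :
    outSet E \ DD ε ⊆ outSet (E ∪ F) := by
  obtain ⟨hpre, hunb⟩ := outSet_preconn hE.isBounded
  have hopen := outSet_isOpen hE.isClosed
  have h1 : IsPreconnected ((outSet E \ {0}) \ DD ε) := by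
    refine preconn_diff (Q := QQ) (preconn_diff_point hpre hopen 0)
      (hopen.sdiff isClosed_singleton) QQ_open ?_ (DD_closed ε) ?_ (QQ_diff_DD_preconn h0 hε)
    · exact fun x hx => ⟨hQ hx, fun h => zero_notMem_QQ (mem_singleton_iff.1 h ▸ hx)⟩
    · rintro x ⟨hx, hx2⟩
      exact DD_subset_QQ hε hx hx2.2
  have h2 : (outSet E \ {0}) \ DD ε = outSet E \ DD ε := by
    ext x
    constructor
    · exact fun h => ⟨h.1.1, h.2⟩
    · exact fun h => ⟨⟨h.1, fun h' => h.2 (mem_singleton_iff.1 h' ▸ zero_mem_DD h0)⟩, h.2⟩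
  rw [h2] at h1
  intro p hp
  refine mem_outSet_of h1 ?_ ?_ hp
  · rintro x hx (h | h)
    · exact hx.1.1 h
    · exact hx.2 (hFD h)
  · intro hb
    apply hunb
    refine (hb.union (DD_bounded ε)).subset ?_
    rw [sdiff_union_self]
    exact subset_union_left

lemma out_union_B {E F : Set Plane} {ε : ℝ} (h0 : 0 < ε) (hε : ε < 2) (hE : IsCompact E)
    (hF : IsCompact F) (hFD : F ⊆ DD ε) (hQ : QQ ⊆ outSet E) :
    outSet F ∩ QQ ⊆ outSet (E ∪ F) := by
  have hA := out_union_A h0 hε hE hFD hQ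
  obtain ⟨hpre, hunb⟩ := outSet_preconn hF.isBounded
  have hopen := outSet_isOpen hF.isClosed
  have hO : IsPreconnected (outSet F \ {0}) := preconn_diff_point hpre hopen 0
  have hOo : IsOpen (outSet F \ {0}) := hopen.sdiff isClosed_singleton
  have hEF : IsClosed (E ∪ F) := hE.isClosed.union hF.isClosed
  set A : Set Plane := (DD ε)ᶜ ∪ QQ ∩ outSet (E ∪ F)
  set B : Set Plane := QQ ∩ ((E ∪ F)ᶜ \ outSet (E ∪ F))
  have hAo : IsOpen A := (DD_closed ε).isOpen_compl.union (QQ_open.inter (outSet_isOpen hEF))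
  have hBo : IsOpen B := QQ_open.inter (inSet_isOpen hEF)
  have hQF : outSet F ∩ QQ ⊆ (E ∪ F)ᶜ := by
    rintro x ⟨hx, hxQ⟩ (h | h)
    · exact (hQ hxQ).1 h
    · exact hx.1 h
  have hcov : outSet F \ {0} ⊆ A ∪ B := by
    rintro x ⟨hx, hx0⟩
    by_cases hxD : x ∈ DD ε
    · have hxQ := DD_subset_QQ hε hxD hx0
      by_cases hxK : x ∈ outSet (E ∪ F)
      · exact Or.inl (Or.inr ⟨hxQ, hxK⟩)
      · exact Or.inr ⟨hxQ, hQF ⟨hx, hxQ⟩, hxK⟩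
    · exact Or.inl (Or.inl hxD)
  have hdis : A ∩ B = ∅ := by
    rw [Set.eq_empty_iff_forall_notMem]
    rintro x ⟨h | h, hx1, hx2⟩
    · exact hx2.2 (hA ⟨hQ hx1, h⟩)
    · exact hx2.2 h.2
  rcases (isPreconnected_iff_subset_of_disjoint.1 hO) A B hAo hBo hcov
    (by rw [hdis, inter_empty]) with h | h
  · rintro x ⟨hx, hxQ⟩
    rcases h ⟨hx, fun h0 => zero_notMem_QQ (mem_singleton_iff.1 h0 ▸ hxQ)⟩ with h | h
    · exact hA ⟨hQ hxQ, h⟩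
    · exact h.2
  · exfalso
    apply hunb
    have hb : Bornology.IsBounded (DD 2 ∪ {0} ∪ DD ε ∪ (Metric.closedBall (0 : Plane) 4)) :=
      (((DD_bounded 2).union Bornology.isBounded_singleton).union (DD_bounded ε)).union
        Metric.isBounded_closedBall
    refine hb.subset ?_
    intro x hx
    by_cases hx0 : x = 0
    · exact Or.inl (Or.inl (Or.inr hx0))
    · have hxB := h ⟨hx, hx0⟩
      right
      obtain ⟨⟨h1, h2, h3, h4⟩, _⟩ := hxB
      rw [Metric.mem_closedBall, dist_zero_right]
      rw [EuclideanSpace.norm_eq, Fin.sum_univ_two, Real.sqrt_le_left (by norm_num)]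
      simp only [Real.norm_eq_abs, sq_abs]
      nlinarith

lemma zero_mem_closure_QQ_diff {ε : ℝ} : (0 : Plane) ∈ closure (QQ \ DD ε) := by
  have hc : Continuous (fun t : ℝ => (!₂[t, 3 / 4 * t] : Plane)) := by fun_prop
  have h1 : Tendsto (fun t : ℝ => (!₂[t, 3 / 4 * t] : Plane)) (𝓝[>] 0) (𝓝 0) := by
    have := (hc.tendsto 0).mono_left (nhdsWithin_le_nhds (s := Ioi 0))
    convert this using 2
    apply plane_ext <;> simp
  refine mem_closure_of_tendsto h1 ?_
  filter_upwards [Ioo_mem_nhdsGT (show (0 : ℝ) < 2 by norm_num)] with t ht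
  refine ⟨?_, ?_⟩
  · simp only [QQ, mem_ofPred_eq]
    simp
    refine ⟨ht.1, ht.2, ?_, ?_⟩ <;> linarith [ht.1]
  · rintro ⟨_, _, _, h⟩
    simp at h
    linarith [ht.1]

lemma cross_zero_notMem_segment {a b : Plane} (h : cross 0 a b ≠ 0) : (0 : Plane) ∉ segment ℝ a b := by
  rintro ⟨s, t, hs, ht, hst, he⟩
  have e0 : s * a 0 + t * b 0 = 0 := by
    have := congrArg (fun p : Plane => p 0) he
    simpa using this
  have e1 : s * a 1 + t * b 1 = 0 := by
    have := congrArg (fun p : Plane => p 1) he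
    simpa using this
  apply h
  simp only [cross, PiLp.zero_apply, sub_zero]
  obtain rfl : t = 1 - s := by linarith
  linear_combination (a 0 + b 0 * 0 - b 0) * e1 * 1 + (b 1 - a 1) * e0

/-- The topological core: glueing along the origin. -/
lemma glue {V : Type} [Finite V] (K : SimpleGraph V) (w : V) (S T : Set V)
    (hunion : S ∪ T = {w}ᶜ) (hdisj : Disjoint S T)
    (hnoedge : ∀ s ∈ S, ∀ t ∈ T, ¬ K.Adj s t) (F : V → Plane) (ε : ℝ) (h0 : 0 < ε) (hε : ε < 2)
    (hG : Good (K.induce (S ∪ {w})) (fun v => F v))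
    (hH : Good (K.induce (T ∪ {w})) (fun v => F v))
    (hFw : F w = 0)
    (hQ : QQ ⊆ outSet (edgeUnion (K.induce (S ∪ {w})) (fun v => F v)))
    (hS : ∀ s ∈ S, |F s 0| ≤ |F s 1|)
    (hT : ∀ t ∈ T, F t ∈ DD ε)
    (hSS : ∀ s ∈ S, ∀ s' ∈ S, s ≠ s' → Disjoint (segment ℝ (F s) (F s')) (DD ε))
    (hgen : InGenPos (range F)) (hinj : Function.Injective F) : Good K F := by
  have hwS : w ∉ S := fun h => by
    have : w ∈ S ∪ T := Or.inl h
    rw [hunion] at this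
    exact this rfl
  have hwT : w ∉ T := fun h => by
    have : w ∈ S ∪ T := Or.inr h
    rw [hunion] at this
    exact this rfl
  have hcases : ∀ v, v = w ∨ v ∈ S ∨ v ∈ T := by
    intro v
    by_cases hv : v = w
    · exact Or.inl hv
    · right
      have : v ∈ S ∪ T := by rw [hunion]; exact hv
      exact this
  set E := edgeUnion (K.induce (S ∪ {w})) (fun v => F v) with hE
  set E' := edgeUnion (K.induce (T ∪ {w})) (fun v => F v) with hE'
  have hEc : IsCompact E := edgeUnion_isCompact _ _
  have hEc' : IsCompact E' := edgeUnion_isCompact _ _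
  have hKE : edgeUnion K F = E ∪ E' := by
    ext x
    simp only [hE, hE', mem_union, mem_edgeUnion]
    constructor
    · rintro ⟨u, v, huv, hx⟩
      by_cases hu : u ∈ T
      · right
        have hv : v ∈ T ∪ {w} := by
          rcases hcases v with h | h | h
          · exact Or.inr h
          · exact absurd huv.symm (hnoedge v h u hu)
          · exact Or.inl h
        exact ⟨⟨u, Or.inl hu⟩, ⟨v, hv⟩, huv, hx⟩
      · by_cases hv : v ∈ T
        · right
          have hu : u ∈ T ∪ {w} := by
            rcases hcases u with h | h | h
            · exact Or.inr h
            · exact absurd huv (hnoedge u h v hv)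
            · exact Or.inl h
          exact ⟨⟨u, hu⟩, ⟨v, Or.inl hv⟩, huv, hx⟩
        · left
          have key : ∀ z, z ∉ T → z ∈ S ∪ {w} := by
            intro z hz
            rcases hcases z with h | h | h
            · exact Or.inr h
            · exact Or.inl h
            · exact absurd h hz
          exact ⟨⟨u, key u hu⟩, ⟨v, key v hv⟩, huv, hx⟩
    · rintro (⟨u, v, huv, hx⟩ | ⟨u, v, huv, hx⟩)
      · exact ⟨u, v, huv, hx⟩
      · exact ⟨u, v, huv, hx⟩
  have hTw : ∀ v : ↥(T ∪ {w}), F v ∈ DD ε := by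
    rintro ⟨v, hv | hv⟩
    · exact hT v hv
    · change F v ∈ _
      rw [mem_singleton_iff.1 hv, hFw]
      exact zero_mem_DD h0
  have hED : E' ⊆ DD ε := by
    intro x hx
    obtain ⟨u, v, _, hx⟩ := (mem_edgeUnion _ _).1 hx
    exact (DD_convex ε).segment_subset (hTw u) (hTw v) hx
  have hA := out_union_A h0 hε hEc hED hQ
  have hB := out_union_B h0 hε hEc hEc' hED hQ
  rw [← hKE] at hA hB
  have hne0 : ∀ v, v ≠ w → F v ≠ 0 := fun v hv h => hv (hinj (h.trans hFw.symm))
  have hSD : ∀ s ∈ S, F s ∉ DD ε := by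
    rintro s hs ⟨h1, h2, h3, h4⟩
    have := hS s hs
    rw [abs_of_nonneg h1] at this
    have h5 : F s 0 = 0 := by
      rcases abs_cases (F s 1) with ⟨h, _⟩ | ⟨h, _⟩ <;> linarith
    have h6 : F s 1 = 0 := by linarith
    exact hne0 s (fun h => hwS (h ▸ hs)) (plane_ext (by simpa using h5) (by simpa using h6))
  have hTQ : ∀ t ∈ T, F t ∈ QQ := fun t ht =>
    DD_subset_QQ hε (hT t ht) (hne0 t (fun h => hwT (h ▸ ht)))
  -- nonadjacent pairs
  have nonSS : ∀ s ∈ S, ∀ s' ∈ S, s ≠ s' → ¬ K.Adj s s' →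
      (segment ℝ (F s) (F s') ∩ outSet (edgeUnion K F)).Nonempty := by
    intro s hs s' hs' hne hna
    obtain ⟨x, hx, hxU⟩ := hG.non ⟨s, Or.inl hs⟩ ⟨s', Or.inl hs'⟩
      (fun h => hne (congrArg Subtype.val h)) hna
    exact ⟨x, hx, hA ⟨hxU, Set.disjoint_left.1 (hSS s hs s' hs' hne) hx⟩⟩
  have nonSw : ∀ s ∈ S, ¬ K.Adj s w →
      (segment ℝ (F s) (F w) ∩ outSet (edgeUnion K F)).Nonempty := by
    intro s hs hna
    have hne : s ≠ w := fun h => hwS (h ▸ hs)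
    obtain ⟨x, hx, hxU⟩ := hG.non ⟨s, Or.inl hs⟩ ⟨w, Or.inr rfl⟩
      (fun h => hne (congrArg Subtype.val h)) hna
    obtain ⟨q, hq, hqU, hq0⟩ := segment_avoid (hinj.ne hne) hx (outSet_isOpen hEc.isClosed) hxU
      (finite_singleton (0 : Plane))
    refine ⟨q, hq, hA ⟨hqU, ?_⟩⟩
    intro hqD
    obtain ⟨a, b, ha, hb, hab, rfl⟩ := hq
    rw [hFw, smul_zero, add_zero] at hqD hq0
    obtain ⟨h1, h2, h3, h4⟩ := hqD
    simp only [PiLp.smul_apply, smul_eq_mul] at h1 h2 h3 h4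
    have hSs := hS s hs
    have hal : |a * F s 0| ≤ |a * F s 1| := by
      rw [abs_mul, abs_mul]
      exact mul_le_mul_of_nonneg_left hSs (abs_nonneg a)
    rw [abs_of_nonneg h1] at hal
    have h5 : a * F s 0 = 0 := by
      rcases abs_cases (a * F s 1) with ⟨h, _⟩ | ⟨h, _⟩ <;> linarith
    have h6 : a * F s 1 = 0 := by linarith
    exact hq0 (plane_ext (by simpa using h5) (by simpa using h6))
  have nonTT : ∀ t t' : ↥(T ∪ {w}), (t : V) ≠ t' → ¬ K.Adj t t' →
      (segment ℝ (F t) (F t') ∩ outSet (edgeUnion K F)).Nonempty := by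
    intro t t' hne hna
    obtain ⟨x, hx, hxU⟩ := hH.non t t' (fun h => hne (congrArg Subtype.val h)) hna
    obtain ⟨q, hq, hqU, hq0⟩ := segment_avoid (hinj.ne hne) hx (outSet_isOpen hEc'.isClosed) hxU
      (finite_singleton (0 : Plane))
    exact ⟨q, hq, hB ⟨hqU, DD_subset_QQ hε ((DD_convex ε).segment_subset (hTw t) (hTw t') hq) hq0⟩⟩
  have nonST : ∀ s ∈ S, ∀ t ∈ T,
      (segment ℝ (F s) (F t) ∩ outSet (edgeUnion K F)).Nonempty := by
    intro s hs t ht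
    have hsw : s ≠ w := fun h => hwS (h ▸ hs)
    have htw : t ≠ w := fun h => hwT (h ▸ ht)
    have hst : s ≠ t := fun h => Set.disjoint_left.1 hdisj hs (h ▸ ht)
    have hseg0 : (0 : Plane) ∉ segment ℝ (F s) (F t) := by
      apply cross_zero_notMem_segment
      rw [Ne, ← collinear_iff_cross, ← hFw]
      exact hgen _ ⟨w, rfl⟩ _ ⟨s, rfl⟩ _ ⟨t, rfl⟩ (hinj.ne hsw.symm) (hinj.ne htw.symm)
        (hinj.ne hst)
    have hpre : IsPreconnected (segment ℝ (F s) (F t)) := (convex_segment _ _).isPreconnected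
    obtain ⟨x, hx, hxD, hxQ⟩ := hpre (DD ε)ᶜ QQ (DD_closed ε).isOpen_compl QQ_open
      (by
        intro x hx
        by_cases hxD : x ∈ DD ε
        · exact Or.inr (DD_subset_QQ hε hxD (fun h => hseg0 (h ▸ hx)))
        · exact Or.inl hxD)
      ⟨F s, left_mem_segment _ _ _, hSD s hs⟩ ⟨F t, right_mem_segment _ _ _, hTQ t ht⟩
    exact ⟨x, hx, hA ⟨hQ hxQ, hxD⟩⟩
  refine ⟨hinj, hgen, ?_, ?_⟩
  · intro u v huv hna
    rcases hcases u with rfl | hu | hu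
    · rcases hcases v with rfl | hv | hv
      · exact absurd rfl huv
      · rw [segment_symm]
        exact nonSw v hv (fun h => hna h.symm)
      · exact nonTT ⟨u, Or.inr rfl⟩ ⟨v, Or.inl hv⟩ huv hna
    · rcases hcases v with rfl | hv | hv
      · exact nonSw u hu hna
      · exact nonSS u hu v hv huv hna
      · exact nonST u hu v hv
    · rcases hcases v with rfl | hv | hv
      · exact nonTT ⟨u, Or.inl hu⟩ ⟨v, Or.inr rfl⟩ huv hna
      · rw [segment_symm]
        exact nonST v hv u hu
      · exact nonTT ⟨u, Or.inl hu⟩ ⟨v, Or.inl hv⟩ huv hna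
  · intro v
    rcases hcases v with rfl | hv | hv
    · rw [hFw]
      exact closure_mono (fun x hx => hA ⟨hQ hx.1, hx.2⟩) zero_mem_closure_QQ_diff
    · have h1 := hG.exposed ⟨v, Or.inl hv⟩
      have h2 := (DD_closed ε).isOpen_compl.inter_closure ⟨hSD v hv, h1⟩
      exact closure_mono (fun x hx => hA ⟨hx.2, hx.1⟩) h2
    · have h1 := hH.exposed ⟨v, Or.inl hv⟩
      have h2 := QQ_open.inter_closure ⟨hTQ v hv, h1⟩
      exact closure_mono (fun x hx => hB ⟨hx.2, hx.1⟩) h2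

lemma Good.cross_ne {V : Type} {G : SimpleGraph V} {f : V → Plane} (h : Good G f) {u v x : V}
    (h1 : u ≠ v) (h2 : u ≠ x) (h3 : v ≠ x) : cross (f u) (f v) (f x) ≠ 0 := by
  rw [Ne, ← collinear_iff_cross]
  exact h.gen _ ⟨u, rfl⟩ _ ⟨v, rfl⟩ _ ⟨x, rfl⟩ (h.inj.ne h1) (h.inj.ne h2) (h.inj.ne h3)

lemma ev_lin {c k : ℝ} (h : c ≠ 0 ∨ k ≠ 0) : ∀ᶠ t in 𝓝[>] (0 : ℝ), c + t * k ≠ 0 := by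
  by_cases hc : c = 0
  · subst hc
    have hk : k ≠ 0 := by simpa using h
    filter_upwards [self_mem_nhdsWithin] with t ht
    have : t ≠ 0 := (mem_Ioi.1 ht).ne'
    simpa using ⟨this, hk⟩
  · have h1 : Tendsto (fun t : ℝ => c + t * k) (𝓝[>] 0) (𝓝 (c + 0 * k)) :=
      ((by fun_prop : Continuous (fun t : ℝ => c + t * k)).tendsto 0).mono_left nhdsWithin_le_nhds
    exact h1.eventually_ne (by simpa using hc)

lemma ev_small (a : ℝ) {b : ℝ} (hb : 0 < b) : ∀ᶠ t in 𝓝[>] (0 : ℝ), t * a < b := by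
  have h1 : Tendsto (fun t : ℝ => t * a) (𝓝[>] 0) (𝓝 (0 * a)) :=
    ((by fun_prop : Continuous (fun t : ℝ => t * a)).tendsto 0).mono_left nhdsWithin_le_nhds
  exact h1.eventually_lt_const (by simpa using hb)

/-- The linear map with given matrix. -/
def linE (a b c d : ℝ) (h : a * d - b * c ≠ 0) : Plane ≃ₗ[ℝ] Plane where
  toFun p := !₂[a * p 0 + b * p 1, c * p 0 + d * p 1]
  invFun p := !₂[(d * p 0 - b * p 1) / (a * d - b * c), (-c * p 0 + a * p 1) / (a * d - b * c)]
  map_add' p q := by apply plane_ext <;> simp <;> ring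
  map_smul' r p := by apply plane_ext <;> simp <;> ring
  left_inv p := by
    apply plane_ext
    · simp only [Matrix.cons_val_zero, Matrix.cons_val_one]
      rw [div_eq_iff h]; ring
    · simp only [Matrix.cons_val_zero, Matrix.cons_val_one]
      rw [div_eq_iff h]; ring
  right_inv p := by
    apply plane_ext
    · simp only [Matrix.cons_val_zero, Matrix.cons_val_one]
      rw [mul_div_assoc', mul_div_assoc', ← add_div, div_eq_iff h]
      ring
    · simp only [Matrix.cons_val_zero, Matrix.cons_val_one]
      rw [mul_div_assoc', mul_div_assoc', ← add_div, div_eq_iff h]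
      ring

lemma linE_zero (a b c d : ℝ) (h : a * d - b * c ≠ 0) (p : Plane) :
    linE a b c d h p 0 = a * p 0 + b * p 1 := rfl

lemma linE_one (a b c d : ℝ) (h : a * d - b * c ≠ 0) (p : Plane) :
    linE a b c d h p 1 = c * p 0 + d * p 1 := rfl

lemma dense_cross {a : Plane} (ha : a ≠ 0) : Dense {p : Plane | cross 0 a p ≠ 0} := by
  intro p
  have hc : Continuous (fun t : ℝ => p + t • (!₂[-(a 1), a 0] : Plane)) := by fun_prop
  have h1 : Tendsto (fun t : ℝ => p + t • (!₂[-(a 1), a 0] : Plane)) (𝓝[>] 0) (𝓝 p) := by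
    have := (hc.tendsto 0).mono_left (nhdsWithin_le_nhds (s := Ioi 0))
    simpa using this
  refine mem_closure_of_tendsto h1 ?_
  have hk : a 0 ^ 2 + a 1 ^ 2 ≠ 0 := by
    intro h
    apply ha
    apply plane_ext
    · simp; nlinarith [sq_nonneg (a 0), sq_nonneg (a 1)]
    · simp; nlinarith [sq_nonneg (a 0), sq_nonneg (a 1)]
  filter_upwards [ev_lin (c := cross 0 a p) (Or.inr hk)] with t ht
  convert ht using 1
  simp [cross]
  ring

lemma isOpen_cross (a : Plane) : IsOpen {p : Plane | cross 0 a p ≠ 0} := by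
  unfold cross
  exact isOpen_ne_fun (by fun_prop) (by fun_prop)

lemma norm_G_arith {P N x y δ ρ : ℝ} (hP : ρ ≤ P) (hN : 0 ≤ N) (hNρ : N < ρ / 4) (hρ : 0 < ρ)
    (hδ0 : 0 < δ) (hδ1 : δ < 1) (h1 : 0 < x) (h2 : x < 2) (h3 : -x < y) (h4 : y < x)
    (e : P ^ 2 = N ^ 2 * (x ^ 2 + δ ^ 2 * y ^ 2)) : False := by
  have b0 : x ^ 2 ≤ 4 := by nlinarith
  have b1 : y ^ 2 ≤ 4 := by nlinarith
  have b2 : δ ^ 2 * y ^ 2 ≤ 1 * 4 :=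
    mul_le_mul (by nlinarith) b1 (sq_nonneg y) (by norm_num)
  have b3 : N ^ 2 * (x ^ 2 + δ ^ 2 * y ^ 2) ≤ N ^ 2 * 8 :=
    mul_le_mul_of_nonneg_left (by linarith) (sq_nonneg N)
  have b4 : N ^ 2 ≤ (ρ / 4) ^ 2 := pow_le_pow_left₀ hN hNρ.le 2
  have b5 : ρ ^ 2 ≤ P ^ 2 := pow_le_pow_left₀ hρ.le hP 2
  nlinarith

set_option maxHeartbeats 1000000 in
lemma norm_G {V : Type} [Finite V] {G : SimpleGraph V} {g : V → Plane} (hG : Good G g) (w : V)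
    (hw : g w = 0) : ∃ φ : Plane ≃ₗ[ℝ] Plane, (∀ s, s ≠ w → |φ (g s) 0| ≤ |φ (g s) 1|) ∧
      QQ ⊆ outSet (edgeUnion G (φ ∘ g)) := by
  classical
  obtain ⟨ρ, hρ, hball⟩ : ∃ ρ : ℝ, 0 < ρ ∧ ∀ u v, u ≠ w → v ≠ w → G.Adj u v →
      ∀ p ∈ segment ℝ (g u) (g v), ρ ≤ ‖p‖ := by
    set X : Set Plane := ⋃ (u : V) (v : V) (_ : G.Adj u v ∧ u ≠ w ∧ v ≠ w),
      segment ℝ (g u) (g v) with hX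
    have hXc : IsCompact X := by
      refine isCompact_iUnion fun u => isCompact_iUnion fun v => isCompact_iUnion fun _ => ?_
      rw [segment_eq_image_lineMap]
      exact isCompact_Icc.image AffineMap.lineMap_continuous
    have h0 : (0 : Plane) ∈ Xᶜ := by
      intro h
      simp only [hX, mem_iUnion] at h
      obtain ⟨u, v, ⟨huv, hu, hv⟩, hx⟩ := h
      refine cross_zero_notMem_segment ?_ hx
      rw [← hw]
      exact hG.cross_ne hu.symm hv.symm huv.ne
    obtain ⟨ρ, hρ, hb⟩ := Metric.isOpen_iff.1 hXc.isClosed.isOpen_compl 0 h0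
    refine ⟨ρ, hρ, fun u v hu hv huv p hp => ?_⟩
    by_contra! hlt
    refine hb (by simpa using hlt : p ∈ Metric.ball 0 ρ) ?_
    simp only [hX, mem_iUnion]
    exact ⟨u, v, ⟨huv, hu, hv⟩, hp⟩
  have hE := edgeUnion_isCompact G g
  have hUo := outSet_isOpen hE.isClosed
  obtain ⟨d, hdU, hdn, hd0, hdc⟩ : ∃ d ∈ outSet (edgeUnion G g), ‖d‖ < ρ / 4 ∧ d ≠ 0 ∧
      ∀ s, s ≠ w → cross 0 (g s) d ≠ 0 := by
    set g' : V → Plane := fun s => if s = w then !₂[1, 0] else g s with hg'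
    have hg0 : ∀ s, g' s ≠ 0 := by
      intro s
      by_cases hs : s = w
      · simp only [hg', hs, if_true]
        intro h
        have := congrArg (fun p : Plane => p 0) h
        simp at this
      · simp only [hg', hs, if_false]
        rw [← hw]
        exact hG.inj.ne hs
    have hdense := dense_iInter_of_isOpen (fun s => isOpen_cross (g' s))
      (fun s => dense_cross (hg0 s))
    have hne : (outSet (edgeUnion G g) ∩ Metric.ball 0 (ρ / 4)).Nonempty := by
      have := hG.exposed w
      rw [hw, Metric.mem_closure_iff] at this
      obtain ⟨b, hb, hb2⟩ := this (ρ / 4) (by linarith)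
      exact ⟨b, hb, by rwa [Metric.mem_ball, dist_comm]⟩
    obtain ⟨d, ⟨hd1, hd2⟩, hd3⟩ := hdense.inter_open_nonempty _ (hUo.inter Metric.isOpen_ball) hne
    rw [mem_iInter] at hd3
    refine ⟨d, hd1, by simpa using hd2, ?_, ?_⟩
    · rintro rfl
      apply hd3 w
      simp [cross]
    · intro s hs
      have := hd3 s
      simpa only [hg', hs, if_false, mem_ofPred_eq] using this
  set D : ℝ := d 0 ^ 2 + d 1 ^ 2 with hD
  have hDpos : 0 < D := by
    rcases (by positivity : 0 ≤ D).lt_or_eq with h | h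
    · exact h
    · exfalso
      apply hd0
      apply plane_ext
      · simp; nlinarith [sq_nonneg (d 0), sq_nonneg (d 1)]
      · simp; nlinarith [sq_nonneg (d 0), sq_nonneg (d 1)]
  have hDn : D = ‖d‖ ^ 2 := by
    rw [EuclideanSpace.norm_sq_eq, Fin.sum_univ_two]
    simp [hD]
  obtain ⟨δ, hδ0, hδ1, hδ⟩ : ∃ δ : ℝ, 0 < δ ∧ δ < 1 ∧ ∀ s, s ≠ w →
      δ * |d 0 * g s 0 + d 1 * g s 1| ≤ |d 0 * g s 1 - d 1 * g s 0| := by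
    have h1 : ∀ᶠ δ in 𝓝[>] (0 : ℝ), ∀ s, s ≠ w →
        δ * |d 0 * g s 0 + d 1 * g s 1| < |d 0 * g s 1 - d 1 * g s 0| := by
      rw [eventually_all]
      intro s
      by_cases hs : s = w
      · simp [hs]
      · have : 0 < |d 0 * g s 1 - d 1 * g s 0| := by
          rw [abs_pos]
          intro h
          apply hdc s hs
          simp [cross]
          linarith
        filter_upwards [ev_small _ this] with t ht _ using ht
    obtain ⟨δ, h1, h2, h3⟩ := (h1.and (Ioo_mem_nhdsGT (show (0 : ℝ) < 1 by norm_num))).exists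
    exact ⟨δ, h2, h3, fun s hs => (h1 s hs).le⟩
  have hdet : (d 0 / D) * (d 0 / (δ * D)) - (d 1 / D) * (-d 1 / (δ * D)) ≠ 0 := by
    have : (d 0 / D) * (d 0 / (δ * D)) - (d 1 / D) * (-d 1 / (δ * D)) = 1 / (δ * D) := by
      field_simp
      rw [hD]; ring
    rw [this]
    positivity
  set φ := linE (d 0 / D) (d 1 / D) (-d 1 / (δ * D)) (d 0 / (δ * D)) hdet with hφ
  have hφ0 : ∀ p, φ p 0 = (d 0 * p 0 + d 1 * p 1) / D := by
    intro p
    rw [hφ, linE_zero]; ring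
  have hφ1 : ∀ p, φ p 1 = (d 0 * p 1 - d 1 * p 0) / (δ * D) := by
    intro p
    rw [hφ, linE_one]; ring
  have hN : ∀ s, |φ (g s) 0| ≤ |φ (g s) 1| := by
    intro s
    by_cases hs : s = w
    · rw [hs, hw]; simp
    · have := hδ s hs
      rw [hφ0, hφ1, abs_div, abs_div, abs_of_pos hDpos, abs_of_pos (mul_pos hδ0 hDpos),
        div_le_div_iff₀ hDpos (mul_pos hδ0 hDpos)]
      nlinarith
  refine ⟨φ, fun s _ => hN s, ?_⟩
  have himg := outSet_edge_image G g φ.toAffineEquiv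
  have hφd : φ d ∈ outSet (edgeUnion G (φ ∘ g)) := himg (mem_image_of_mem _ hdU)
  have hdQ : φ d ∈ QQ := by
    have e0 : φ d 0 = 1 := by rw [hφ0, div_eq_one_iff_eq hDpos.ne', hD]; ring
    have e1 : φ d 1 = 0 := by
      rw [hφ1]
      have : d 0 * d 1 - d 1 * d 0 = 0 := by ring
      rw [this, zero_div]
    simp only [QQ, mem_ofPred_eq, e0, e1]
    norm_num
  refine outSet_absorb QQ_convex.isPreconnected ?_ hdQ hφd
  -- `QQ` avoids the drawing
  have hinc : ∀ s q, q ∈ QQ → q ∉ segment ℝ 0 (φ (g s)) := by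
    rintro s q ⟨h1, h2, h3, h4⟩ ⟨a, b, ha, hb, hab, rfl⟩
    simp only [smul_zero, zero_add, PiLp.smul_apply, smul_eq_mul] at h1 h2 h3 h4
    have h5 : |b * φ (g s) 0| ≤ |b * φ (g s) 1| := by
      rw [abs_mul, abs_mul]
      exact mul_le_mul_of_nonneg_left (hN s) (abs_nonneg b)
    rw [abs_of_pos h1] at h5
    rcases abs_cases (b * φ (g s) 1) with ⟨h, _⟩ | ⟨h, _⟩ <;> linarith
  intro q hq hqE
  obtain ⟨u, v, huv, hqs⟩ := (mem_edgeUnion _ _).1 hqE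
  simp only [Function.comp] at hqs
  by_cases hu : u = w
  · rw [hu, hw, map_zero] at hqs
    exact hinc v q hq hqs
  by_cases hv : v = w
  · rw [hv, hw, map_zero, segment_symm] at hqs
    exact hinc u q hq hqs
  have h2 := image_segment ℝ φ.toAffineEquiv.toAffineMap (g u) (g v)
  have h3 : q ∈ φ.toAffineEquiv.toAffineMap '' segment ℝ (g u) (g v) := h2 ▸ hqs
  obtain ⟨p, hp, rfl⟩ := h3
  have hpn := hball u v hu hv huv p hp
  change φ p ∈ QQ at hq
  obtain ⟨k1, k2, k3, k4⟩ := hq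
  have e0 : d 0 * p 0 + d 1 * p 1 = φ p 0 * D := by rw [hφ0, div_mul_cancel₀ _ hDpos.ne']
  have e1 : d 0 * p 1 - d 1 * p 0 = φ p 1 * (δ * D) := by
    rw [hφ1, div_mul_cancel₀ _ (mul_pos hδ0 hDpos).ne']
  have hpn2 : ‖p‖ ^ 2 = p 0 ^ 2 + p 1 ^ 2 := by
    rw [EuclideanSpace.norm_sq_eq, Fin.sum_univ_two]
    simp
  have e2 : ‖p‖ ^ 2 * D = D * D * (φ p 0 ^ 2 + δ ^ 2 * φ p 1 ^ 2) := by
    have : ‖p‖ ^ 2 * D = (d 0 * p 0 + d 1 * p 1) ^ 2 + (d 0 * p 1 - d 1 * p 0) ^ 2 := by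
      rw [hpn2, hD]; ring
    rw [this, e0, e1]; ring
  have e3 : ‖p‖ ^ 2 = D * (φ p 0 ^ 2 + δ ^ 2 * φ p 1 ^ 2) := by
    have : ‖p‖ ^ 2 * D = (D * (φ p 0 ^ 2 + δ ^ 2 * φ p 1 ^ 2)) * D := by rw [e2]; ring
    exact mul_right_cancel₀ hDpos.ne' this
  rw [hDn] at e3
  exact norm_G_arith hpn (norm_nonneg d) hdn hρ hδ0 hδ1 k1 k2 k3 k4 e3

lemma norm_H {V : Type} [Finite V] {h : V → Plane} (w : V) (hw : h w = 0) {α β : ℝ}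
    (hpos : ∀ t, t ≠ w → 0 < α * h t 0 + β * h t 1) : ∃ φ : Plane ≃ₗ[ℝ] Plane,
      ∀ t, φ (h t) ∈ DD 1 := by
  by_cases htriv : ∀ t, t = w
  · refine ⟨LinearEquiv.refl ℝ Plane, fun t => ?_⟩
    rw [htriv t, hw, map_zero]
    exact zero_mem_DD one_pos
  push Not at htriv
  obtain ⟨t₀, ht₀⟩ := htriv
  have hαβ : 0 < α ^ 2 + β ^ 2 := by
    rcases (by positivity : 0 ≤ α ^ 2 + β ^ 2).lt_or_eq with h' | h'
    · exact h'
    · exfalso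
      have ha : α = 0 := by nlinarith [sq_nonneg α, sq_nonneg β]
      have hb : β = 0 := by nlinarith [sq_nonneg α, sq_nonneg β]
      have := hpos t₀ ht₀
      simp [ha, hb] at this
  obtain ⟨δ, hδ, hδ0⟩ : ∃ δ : ℝ, (∀ t, t ≠ w →
      δ * (2 * |α * h t 1 - β * h t 0|) < α * h t 0 + β * h t 1) ∧ 0 < δ := by
    have h1 : ∀ᶠ δ in 𝓝[>] (0 : ℝ), ∀ t, t ≠ w →
        δ * (2 * |α * h t 1 - β * h t 0|) < α * h t 0 + β * h t 1 := by
      rw [eventually_all]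
      intro t
      by_cases ht : t = w
      · simp [ht]
      · filter_upwards [ev_small _ (hpos t ht)] with x hx _ using hx
    exact (h1.and self_mem_nhdsWithin).exists
  obtain ⟨η, hη, hη0⟩ : ∃ η : ℝ, (∀ t, η * (α * h t 0 + β * h t 1) < 1) ∧ 0 < η := by
    have h1 : ∀ᶠ η in 𝓝[>] (0 : ℝ), ∀ t, η * (α * h t 0 + β * h t 1) < 1 := by
      rw [eventually_all]
      exact fun t => ev_small _ one_pos
    exact (h1.and self_mem_nhdsWithin).exists
  have hdet : (η * α) * (η * δ * α) - (η * β) * (-(η * δ * β)) ≠ 0 := by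
    have : (η * α) * (η * δ * α) - (η * β) * (-(η * δ * β)) = η ^ 2 * δ * (α ^ 2 + β ^ 2) := by
      ring
    rw [this]
    positivity
  refine ⟨linE _ _ _ _ hdet, fun t => ?_⟩
  by_cases ht : t = w
  · rw [ht, hw, map_zero]
    exact zero_mem_DD one_pos
  have h1 := hpos t ht
  have h2 := hδ t ht
  have h3 := hη t
  set X := α * h t 0 + β * h t 1
  set Y := α * h t 1 - β * h t 0 with hY
  have e0 : linE _ _ _ _ hdet (h t) 0 = η * X := by rw [linE_zero]; ring
  have e1 : linE _ _ _ _ hdet (h t) 1 = η * (δ * Y) := by rw [linE_one]; ring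
  have h4 : δ * Y ≤ δ * |Y| := mul_le_mul_of_nonneg_left (le_abs_self Y) hδ0.le
  have h5 : δ * (-Y) ≤ δ * |Y| := mul_le_mul_of_nonneg_left (neg_le_abs Y) hδ0.le
  simp only [DD, mem_ofPred_eq, e0, e1]
  refine ⟨by positivity, h3.le, ?_, ?_⟩
  · nlinarith
  · nlinarith

lemma extreme_functional {V : Type} [Finite V] {h : V → Plane} (w : V) (hinj : Function.Injective h)
    (hex : IsExtremePt (h w) (range h)) : ∃ α β : ℝ, ∀ t, t ≠ w →
      0 < α * (h t 0 - h w 0) + β * (h t 1 - h w 1) := by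
  unfold IsExtremePt at hex
  have hfin : (range h \ {h w}).Finite := (finite_range h).subset sdiff_subset
  obtain ⟨f, u, hu, hf⟩ := geometric_hahn_banach_point_closed (convex_convexHull ℝ _)
    (hfin.isCompact_convexHull ℝ).isClosed hex
  have hrep : ∀ p : Plane, f p = f !₂[1, 0] * p 0 + f !₂[0, 1] * p 1 := by
    intro p
    have : p = p 0 • (!₂[1, 0] : Plane) + p 1 • (!₂[0, 1] : Plane) := by
      apply plane_ext <;> simp
    conv_lhs => rw [this]
    rw [map_add, map_smul, map_smul, smul_eq_mul, smul_eq_mul]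
    ring
  refine ⟨f !₂[1, 0], f !₂[0, 1], fun t ht => ?_⟩
  have h1 := hf (h t) (subset_convexHull ℝ _ ⟨⟨t, rfl⟩, fun e => ht (hinj e)⟩)
  have h2 := hu.trans h1
  rw [hrep (h w), hrep (h t)] at h2
  linarith

lemma cross_swap (p q r : Plane) : cross q p r = -cross p q r := by unfold cross; ring

lemma cross_rot (p q r : Plane) : cross q r p = cross p q r := by unfold cross; ring

lemma glue_scaled {V : Type} [Finite V] (K : SimpleGraph V) (w : V) (S T : Set V)
    (hunion : S ∪ T = {w}ᶜ) (hdisj : Disjoint S T)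
    (hnoedge : ∀ s ∈ S, ∀ t ∈ T, ¬ K.Adj s t) (g h : V → Plane)
    (hG : Good (K.induce (S ∪ {w})) (fun v => g v))
    (hH : Good (K.induce (T ∪ {w})) (fun v => h v))
    (hgw : g w = 0) (hhw : h w = 0)
    (hQ : QQ ⊆ outSet (edgeUnion (K.induce (S ∪ {w})) (fun v => g v)))
    (hS : ∀ s ∈ S, |g s 0| ≤ |g s 1|)
    (hT : ∀ t ∈ T, h t ∈ DD 1) : ∃ F, Good K F := by
  classical
  have hwS : w ∉ S := fun h => by
    have : w ∈ S ∪ T := Or.inl h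
    rw [hunion] at this
    exact this rfl
  have hwT : w ∉ T := fun h => by
    have : w ∈ S ∪ T := Or.inr h
    rw [hunion] at this
    exact this rfl
  have hcases : ∀ v, v ∈ T ∨ v ∈ S ∨ v = w := by
    intro v
    by_cases hv : v = w
    · exact Or.inr (Or.inr hv)
    · have : v ∈ S ∪ T := by rw [hunion]; exact hv
      rcases this with h | h
      · exact Or.inr (Or.inl h)
      · exact Or.inl h
  have hSw : ∀ s ∈ S, s ≠ w := fun s hs e => hwS (e ▸ hs)
  have hTw : ∀ s ∈ T, s ≠ w := fun s hs e => hwT (e ▸ hs)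
  have hGc : ∀ u v x : V, u ∈ S ∪ {w} → v ∈ S ∪ {w} → x ∈ S ∪ {w} → u ≠ v → u ≠ x → v ≠ x →
      cross (g u) (g v) (g x) ≠ 0 := by
    intro u v x hu hv hx h1 h2 h3
    exact hG.cross_ne (u := ⟨u, hu⟩) (v := ⟨v, hv⟩) (x := ⟨x, hx⟩)
      (fun e => h1 (congrArg Subtype.val e)) (fun e => h2 (congrArg Subtype.val e))
      (fun e => h3 (congrArg Subtype.val e))
  have hHc : ∀ u v x : V, u ∈ T ∪ {w} → v ∈ T ∪ {w} → x ∈ T ∪ {w} → u ≠ v → u ≠ x → v ≠ x →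
      cross (h u) (h v) (h x) ≠ 0 := by
    intro u v x hu hv hx h1 h2 h3
    exact hH.cross_ne (u := ⟨u, hu⟩) (v := ⟨v, hv⟩) (x := ⟨x, hx⟩)
      (fun e => h1 (congrArg Subtype.val e)) (fun e => h2 (congrArg Subtype.val e))
      (fun e => h3 (congrArg Subtype.val e))
  -- choose the scale
  have c2 : ∀ᶠ ε in 𝓝[>] (0 : ℝ), ∀ s s' : V, s ∈ S → s' ∈ S → s ≠ s' →
      Disjoint (segment ℝ (g s) (g s')) (DD ε) := by
    rw [eventually_all]; intro s
    rw [eventually_all]; intro s'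
    by_cases hh : s ∈ S ∧ s' ∈ S ∧ s ≠ s'
    · obtain ⟨hs, hs', hne⟩ := hh
      have h0 : (0 : Plane) ∈ (segment ℝ (g s) (g s'))ᶜ := by
        apply cross_zero_notMem_segment
        rw [← hgw]
        exact hGc w s s' (Or.inr rfl) (Or.inl hs) (Or.inl hs') (hSw s hs).symm (hSw s' hs').symm hne
      have hcl : IsClosed (segment ℝ (g s) (g s')) := by
        rw [segment_eq_image_lineMap]
        exact (isCompact_Icc.image AffineMap.lineMap_continuous).isClosed
      obtain ⟨r, hr, hb⟩ := Metric.isOpen_iff.1 hcl.isOpen_compl 0 h0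
      filter_upwards [ev_small 2 hr] with ε hε _ _ _
      rw [Set.disjoint_right]
      intro x hx
      apply hb
      have := DD_norm hx
      rw [Metric.mem_ball, dist_zero_right]
      linarith
    · exact Eventually.of_forall fun ε a b c => absurd ⟨a, b, c⟩ hh
  have c3 : ∀ᶠ ε in 𝓝[>] (0 : ℝ), ∀ s s' t : V, s ∈ S → s' ∈ S → s ≠ s' →
      cross (g s) (g s') (ε • h t) ≠ 0 := by
    rw [eventually_all]; intro s
    rw [eventually_all]; intro s'
    rw [eventually_all]; intro t
    by_cases hh : s ∈ S ∧ s' ∈ S ∧ s ≠ s'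
    · obtain ⟨hs, hs', hne⟩ := hh
      have h0 := hGc s s' w (Or.inl hs) (Or.inl hs') (Or.inr rfl) hne (hSw s hs) (hSw s' hs')
      filter_upwards [ev_lin (k := (g s' 0 - g s 0) * h t 1 - (g s' 1 - g s 1) * h t 0)
        (Or.inl h0)] with ε hε _ _ _
      convert hε using 1
      simp only [cross, hgw, PiLp.smul_apply, PiLp.zero_apply, smul_eq_mul]
      ring
    · exact Eventually.of_forall fun ε a b c => absurd ⟨a, b, c⟩ hh
  have c4 : ∀ᶠ ε in 𝓝[>] (0 : ℝ), ∀ s t t' : V, t ∈ T → t' ∈ T → t ≠ t' →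
      cross (g s) (ε • h t) (ε • h t') ≠ 0 := by
    rw [eventually_all]; intro s
    rw [eventually_all]; intro t
    rw [eventually_all]; intro t'
    by_cases hh : t ∈ T ∧ t' ∈ T ∧ t ≠ t'
    · obtain ⟨ht, ht', hne⟩ := hh
      have h0 := hHc w t t' (Or.inr rfl) (Or.inl ht) (Or.inl ht') (hTw t ht).symm (hTw t' ht').symm
        hne
      filter_upwards [ev_lin (c := (g s 1) * (h t' 0 - h t 0) - (g s 0) * (h t' 1 - h t 1))
        (Or.inr h0), self_mem_nhdsWithin] with ε hε hε0 _ _ _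
      have hε0 : ε ≠ 0 := (mem_Ioi.1 hε0).ne'
      convert mul_ne_zero hε0 hε using 1
      simp only [cross, hhw, PiLp.smul_apply, PiLp.zero_apply, smul_eq_mul]
      ring
    · exact Eventually.of_forall fun ε a b c => absurd ⟨a, b, c⟩ hh
  obtain ⟨ε, ⟨⟨h2, h3⟩, h4⟩, hε0, hε2⟩ :=
    (((c2.and c3).and c4).and (Ioo_mem_nhdsGT (show (0 : ℝ) < 2 by norm_num))).exists
  set F : V → Plane := fun v => if v ∈ T then ε • h v else g v with hF
  have hFT : ∀ v ∈ T, F v = ε • h v := fun v hv => by simp only [hF, hv, if_true]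
  have hFn : ∀ v, v ∉ T → F v = g v := fun v hv => by simp only [hF, hv, if_false]
  have hST : ∀ v ∈ S, v ∉ T := fun v hv => Set.disjoint_left.1 hdisj hv
  have hFw : F w = 0 := by rw [hFn w hwT, hgw]
  have hFT' : ∀ v ∈ T ∪ {w}, F v = ε • h v := by
    rintro v (hv | hv)
    · exact hFT v hv
    · rw [mem_singleton_iff.1 hv, hFw, hhw, smul_zero]
  have hFS' : ∀ v ∈ S ∪ {w}, F v = g v := by
    rintro v (hv | hv)
    · exact hFn v (hST v hv)
    · rw [mem_singleton_iff.1 hv, hFw, hgw]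
  have hFD : ∀ t ∈ T, F t ∈ DD ε := by
    intro t ht
    obtain ⟨k1, k2, k3, k4⟩ := hT t ht
    rw [hFT t ht]
    simp only [DD, mem_ofPred_eq, PiLp.smul_apply, smul_eq_mul]
    refine ⟨by positivity, by nlinarith, by nlinarith, by nlinarith⟩
  have hGeq : (fun v : ↥(S ∪ {w}) => F (v : V)) = (fun v : ↥(S ∪ {w}) => g (v : V)) :=
    funext fun v => hFS' v v.2
  have hHeq : (fun v : ↥(T ∪ {w}) => F (v : V)) = (fun v : ↥(T ∪ {w}) => ε • h (v : V)) :=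
    funext fun v => hFT' v v.2
  have hG' : Good (K.induce (S ∪ {w})) (fun v => F v) := by rw [hGeq]; exact hG
  have hH' : Good (K.induce (T ∪ {w})) (fun v => F v) := by
    rw [hHeq]
    exact hH.map (LinearEquiv.smulOfNeZero ℝ Plane ε hε0.ne').toAffineEquiv
  have hGc' : ∀ u v x : V, u ∈ S ∪ {w} → v ∈ S ∪ {w} → x ∈ S ∪ {w} → u ≠ v → u ≠ x → v ≠ x →
      cross (F u) (F v) (F x) ≠ 0 := by
    intro u v x hu hv hx k1 k2 k3
    rw [hFS' u hu, hFS' v hv, hFS' x hx]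
    exact hGc u v x hu hv hx k1 k2 k3
  have hHc' : ∀ u v x : V, u ∈ T ∪ {w} → v ∈ T ∪ {w} → x ∈ T ∪ {w} → u ≠ v → u ≠ x → v ≠ x →
      cross (F u) (F v) (F x) ≠ 0 := by
    intro u v x hu hv hx k1 k2 k3
    exact hH'.cross_ne (u := ⟨u, hu⟩) (v := ⟨v, hv⟩) (x := ⟨x, hx⟩)
      (fun e => k1 (congrArg Subtype.val e)) (fun e => k2 (congrArg Subtype.val e))
      (fun e => k3 (congrArg Subtype.val e))
  have c5 : ∀ s ∈ S, ∀ t ∈ T, cross 0 (F s) (F t) ≠ 0 := by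
    intro s hs t ht hc
    obtain ⟨k1, k2, k3, k4⟩ := hFD t ht
    have hs1 : F t ≠ 0 := by
      rw [hFT t ht, ← smul_zero ε]
      intro e
      have e2 : h t = h w := by
        rw [hhw]; exact smul_right_injective Plane hε0.ne' e
      exact hTw t ht (congrArg Subtype.val
        (hH.inj (a₁ := ⟨t, Or.inl ht⟩) (a₂ := ⟨w, Or.inr rfl⟩) e2))
    have hs2 : g s ≠ 0 := by
      intro e
      have e2 : g s = g w := by rw [hgw, e]
      exact hSw s hs (congrArg Subtype.val
        (hG.inj (a₁ := ⟨s, Or.inl hs⟩) (a₂ := ⟨w, Or.inr rfl⟩) e2))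
    obtain ⟨q1, -, q3, q4⟩ := DD_subset_QQ hε2 (hFD t ht) hs1
    have hs3 := hS s hs
    rw [hFn s (hST s hs)] at hc
    simp only [cross, PiLp.zero_apply, sub_zero] at hc
    have hy : 0 < |g s 1| := by
      rw [abs_pos]
      intro hy
      rw [hy, abs_zero] at hs3
      have hx : g s 0 = 0 := abs_eq_zero.1 (le_antisymm hs3 (abs_nonneg _))
      exact hs2 (plane_ext (by simpa using hx) (by simpa using hy))
    have hlt : |F t 1| < F t 0 := abs_lt.2 ⟨q3, q4⟩
    have heq : |g s 0| * |F t 1| = |g s 1| * F t 0 := by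
      have : g s 0 * F t 1 = g s 1 * F t 0 := by linarith
      rw [← abs_mul, this, abs_mul, abs_of_pos q1]
    have : |g s 0| * |F t 1| ≤ |g s 1| * |F t 1| :=
      mul_le_mul_of_nonneg_right hs3 (abs_nonneg _)
    have : |g s 1| * |F t 1| < |g s 1| * F t 0 := mul_lt_mul_of_pos_left hlt hy
    linarith
  -- two points outside `T`, one in `T`
  have sst : ∀ u v x : V, u ∈ S ∪ {w} → v ∈ S ∪ {w} → x ∈ T → u ≠ v →
      cross (F u) (F v) (F x) ≠ 0 := by
    rintro u v x (hu | hu) (hv | hv) hx huv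
    · rw [hFn u (hST u hu), hFn v (hST v hv), hFT x hx]
      exact h3 u v x hu hv huv
    · rw [mem_singleton_iff.1 hv, hFw, cross_swap]
      exact neg_ne_zero.2 (c5 u hu x hx)
    · rw [mem_singleton_iff.1 hu, hFw]
      exact c5 v hv x hx
    · exact absurd ((mem_singleton_iff.1 hu).trans (mem_singleton_iff.1 hv).symm) huv
  have stt : ∀ u v x : V, u ∈ S ∪ {w} → v ∈ T → x ∈ T → v ≠ x →
      cross (F u) (F v) (F x) ≠ 0 := by
    intro u v x hu hv hx hvx
    rw [hFS' u hu, hFT v hv, hFT x hx]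
    exact h4 u v x hv hx hvx
  have hcases2 : ∀ v, v ∈ T ∨ v ∈ S ∪ {w} := by
    intro v
    rcases hcases v with h | h | h
    · exact Or.inl h
    · exact Or.inr (Or.inl h)
    · exact Or.inr (Or.inr h)
  have hcross : ∀ u v x : V, u ≠ v → u ≠ x → v ≠ x → cross (F u) (F v) (F x) ≠ 0 := by
    intro u v x k1 k2 k3
    rcases hcases2 u with hu | hu <;> rcases hcases2 v with hv | hv <;>
      rcases hcases2 x with hx | hx
    · exact hHc' u v x (Or.inl hu) (Or.inl hv) (Or.inl hx) k1 k2 k3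
    · rw [← cross_rot, ← cross_rot]
      exact stt x u v hx hu hv k1
    · rw [← cross_rot]
      exact stt v x u hv hx hu k2.symm
    · rw [← cross_rot]
      exact sst v x u hv hx hu k3
    · exact stt u v x hu hv hx k3
    · rw [← cross_rot, ← cross_rot]
      exact sst x u v hx hu hv k2.symm
    · exact sst u v x hu hv hx k1
    · exact hGc' u v x hu hv hx k1 k2 k3
  have hinjST : ∀ u v : V, u ∈ S ∪ {w} → v ∈ T → F u ≠ F v := by
    rintro u v (hu | hu) hv e
    · apply c5 u hu v hv
      rw [e]
      unfold cross
      ring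
    · have hu' := mem_singleton_iff.1 hu
      subst hu'
      exact hTw v hv (congrArg Subtype.val
        (hH'.inj (a₁ := ⟨v, Or.inl hv⟩) (a₂ := ⟨u, Or.inr rfl⟩) e.symm))
  have hinj : Function.Injective F := by
    intro u v e
    rcases hcases2 u with hu | hu <;> rcases hcases2 v with hv | hv
    · exact congrArg Subtype.val (hH'.inj (a₁ := ⟨u, Or.inl hu⟩) (a₂ := ⟨v, Or.inl hv⟩) e)
    · exact absurd e.symm (hinjST v u hv hu)
    · exact absurd e (hinjST u v hu hv)
    · exact congrArg Subtype.val (hG'.inj (a₁ := ⟨u, hu⟩) (a₂ := ⟨v, hv⟩) e)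
  refine ⟨F, glue K w S T hunion hdisj hnoedge F ε hε0 hε2 hG' hH' hFw ?_ ?_ hFD ?_ ?_ hinj⟩
  · rw [hGeq]; exact hQ
  · intro s hs
    rw [hFn s (hST s hs)]
    exact hS s hs
  · intro s hs s' hs' hne
    rw [hFn s (hST s hs), hFn s' (hST s' hs')]
    exact h2 s s' hs hs' hne
  · rintro _ ⟨u, rfl⟩ _ ⟨v, rfl⟩ _ ⟨x, rfl⟩ k1 k2 k3
    rw [collinear_iff_cross]
    exact hcross u v x (fun e => k1 (congrArg F e)) (fun e => k2 (congrArg F e))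
      (fun e => k3 (congrArg F e))

/-- Translate a good representation so that `w` is at the origin. -/
lemma Good.translate {V : Type} {G : SimpleGraph V} {f : V → Plane} (h : Good G f) (w : V) :
    Good G (fun v => f v - f w) := by
  have := h.map (AffineEquiv.constVAdd ℝ Plane (-(f w)))
  convert this using 1
  ext1 v
  simp [sub_eq_neg_add]

/-- If `K` is a graph, `w` a vertex, and `S, T` a partition of the
remaining vertices with no `K`-edge between `S` and `T`, and the induced subgraphs
`G = K[S ∪ {w}]` and `H = K[T ∪ {w}]` have exposed outside-obstacle representations
(with `w` placed at an extreme point in the representation of `H`), then `K` has an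
exposed outside-obstacle representation. -/
theorem identify_exposed_outsideObstacleRep
    {V : Type} [Fintype V] (K : SimpleGraph V) (w : V) (S T : Set V)
    (hunion : S ∪ T = {w}ᶜ) (hdisj : Disjoint S T)
    (hnoedge : ∀ s ∈ S, ∀ t ∈ T, ¬ K.Adj s t)
    (hG : ∃ (f : ↥(S ∪ {w}) → Plane) (C : Set Plane),
      IsExposedOutsideObstacleRep (K.induce (S ∪ {w})) f C)
    (hH : ∃ (f : ↥(T ∪ {w}) → Plane) (C : Set Plane),
      IsExposedOutsideObstacleRep (K.induce (T ∪ {w})) f C ∧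
      IsExtremePt (f ⟨w, Set.mem_union_right T rfl⟩) (Set.range f)) :
    ∃ (f : V → Plane) (C : Set Plane), IsExposedOutsideObstacleRep K f C := by
  classical
  obtain ⟨g₀, C, hg⟩ := hG
  obtain ⟨h₀, C', hh, hex⟩ := hH
  set wG : ↥(S ∪ {w}) := ⟨w, Set.mem_union_right S rfl⟩ with hwG
  set wH : ↥(T ∪ {w}) := ⟨w, Set.mem_union_right T rfl⟩ with hwH
  have hg1 := (Good.of_rep hg).translate wG
  obtain ⟨φ, hφ1, hφ2⟩ := norm_G hg1 wG (by simp)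
  have hg2 := hg1.map φ.toAffineEquiv
  have hh0 := Good.of_rep hh
  obtain ⟨α, β, hαβ⟩ := extreme_functional wH hh0.inj hex
  have hh1 := hh0.translate wH
  obtain ⟨ψ, hψ⟩ := norm_H (h := fun v => h₀ v - h₀ wH) wH (by simp) (α := α) (β := β)
    (fun t ht => by simpa using hαβ t ht)
  have hh2 := hh1.map ψ.toAffineEquiv
  set g : V → Plane := fun v => if hv : v ∈ S ∪ {w} then φ (g₀ ⟨v, hv⟩ - g₀ wG) else 0 with hgdef
  set h : V → Plane := fun v => if hv : v ∈ T ∪ {w} then ψ (h₀ ⟨v, hv⟩ - h₀ wH) else 0 with hhdef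
  have hgv : ∀ v (hv : v ∈ S ∪ {w}), g v = φ (g₀ ⟨v, hv⟩ - g₀ wG) := fun v hv => by
    simp only [hgdef, dif_pos hv]
  have hhv : ∀ v (hv : v ∈ T ∪ {w}), h v = ψ (h₀ ⟨v, hv⟩ - h₀ wH) := fun v hv => by
    simp only [hhdef, dif_pos hv]
  have hgeq : (fun v : ↥(S ∪ {w}) => g v) = φ.toAffineEquiv ∘ fun v => g₀ v - g₀ wG :=
    funext fun v => hgv v v.2
  have hheq : (fun v : ↥(T ∪ {w}) => h v) = ψ.toAffineEquiv ∘ fun v => h₀ v - h₀ wH :=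
    funext fun v => hhv v v.2
  have hwS : w ∉ S := fun h => by
    have : w ∈ S ∪ T := Or.inl h
    rw [hunion] at this
    exact this rfl
  obtain ⟨F, hF⟩ := glue_scaled K w S T hunion hdisj hnoedge g h
    (by rw [hgeq]; exact hg2) (by rw [hheq]; exact hh2)
    (by rw [hgv w (Or.inr rfl), sub_self, map_zero])
    (by rw [hhv w (Or.inr rfl), sub_self, map_zero])
    (by rw [hgeq]; exact hφ2)
    (by
      intro s hs
      rw [hgv s (Or.inl hs)]
      exact hφ1 ⟨s, Or.inl hs⟩ (fun e => hwS (by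
        have : s = w := congrArg Subtype.val e
        exact this ▸ hs)))
    (by
      intro t ht
      rw [hhv t (Or.inl ht)]
      exact hψ ⟨t, Or.inl ht⟩)
  obtain ⟨D, hD⟩ := hF.to_rep
  exact ⟨F, D, hD⟩

end
end

section
/- Let (f, C) be an outside-obstacle representation of a finite simple graph G, and let Z and Z' be cliques of G. If the convex hulls CH(f(Z)) and CH(f(Z')) are exactly t-crossing, then every vertex z ∈ Z has at least t−1 neighbors in Z' (i.e., at least t−1 vertices of Z' are adjacent to z in G), and every vertex z' ∈ Z' has at least t−1 neighbors in Z. -/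
noncomputable section

/-- A real function on the plane preserving affine combinations of two points. -/
def AffFun (h : Plane → ℝ) : Prop :=
  ∀ (x y : Plane) (a b : ℝ), a + b = 1 → h (a • x + b • y) = a * h x + b * h y

/-- Affine coordinates centred at `z`. -/
structure IsView (z : Plane) (Φ Ψ : Plane → ℝ) : Prop where
  aff1 : AffFun Φ
  aff2 : AffFun Ψ
  z1 : Φ z = 0
  z2 : Ψ z = 0
  inj : ∀ x y, Φ x = Φ y → Ψ x = Ψ y → x = y

lemma AffFun.exists_ge {h : Plane → ℝ} (hh : AffFun h) {B : Set Plane} {y : Plane}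
    (hy : y ∈ convexHull ℝ B) : ∃ b ∈ B, h y ≤ h b := by
  by_contra! hc
  have hconv : Convex ℝ {x | h x < h y} := by
    intro x hx x' hx' a b ha hb hab
    change h x < h y at hx
    change h x' < h y at hx'
    change h _ < h y
    rw [hh _ _ _ _ hab]
    have hb' : b = 1 - a := by linarith
    subst hb'
    rcases eq_or_lt_of_le ha with h0 | h0
    · subst h0; simpa using hx'
    · nlinarith
  have : h y < h y := convexHull_min (show B ⊆ {x | h x < h y} from fun b hb => hc b hb) hconv hy
  exact lt_irrefl _ this

lemma AffFun.comb {f g : Plane → ℝ} (hf : AffFun f) (hg : AffFun g) (α β γ : ℝ) :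
    AffFun (fun x => α * f x + β * g x + γ) := by
  intro x y a b hab
  simp only [hf x y a b hab, hg x y a b hab]
  linear_combination (-γ) * hab

lemma exists_view {z : Plane} {L : Set Plane} (hL : Convex ℝ L) (hc : IsClosed L)
    (hne : L.Nonempty) (hz : z ∉ L) : ∃ Φ Ψ, IsView z Φ Ψ ∧ ∀ x ∈ L, 0 < Φ x := by
  obtain ⟨f, u, hu, hf⟩ := geometric_hahn_banach_point_closed hL hc hz
  obtain ⟨x0, hx0⟩ := hne
  set a := f (EuclideanSpace.single 0 1) with ha
  set b := f (EuclideanSpace.single 1 1) with hb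
  have hfe : ∀ v : Plane, f v = a * v 0 + b * v 1 := by
    intro v
    have hv : v = v 0 • EuclideanSpace.single (0 : Fin 2) (1 : ℝ)
        + v 1 • EuclideanSpace.single (1 : Fin 2) (1 : ℝ) := by
      ext i; fin_cases i <;> simp
    conv_lhs => rw [hv]
    rw [map_add, map_smul, map_smul, smul_eq_mul, smul_eq_mul]
    ring
  have hab : 0 < a ^ 2 + b ^ 2 := by
    by_contra hcon
    have h1 : a = 0 := by nlinarith [sq_nonneg a, sq_nonneg b]
    have h2 : b = 0 := by nlinarith [sq_nonneg a, sq_nonneg b]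
    have := hf x0 hx0
    rw [hfe] at this hu
    rw [h1, h2] at this hu
    linarith
  refine ⟨fun x => a * (x 0 - z 0) + b * (x 1 - z 1),
    fun x => a * (x 1 - z 1) - b * (x 0 - z 0), ⟨?_, ?_, ?_, ?_, ?_⟩, ?_⟩
  · intro x y c d hcd
    simp only [PiLp.add_apply, PiLp.smul_apply, smul_eq_mul]
    linear_combination (a * z 0 + b * z 1) * hcd
  · intro x y c d hcd
    simp only [PiLp.add_apply, PiLp.smul_apply, smul_eq_mul]
    linear_combination (a * z 1 - b * z 0) * hcd
  · simp
  · simp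
  · intro x y h1 h2
    simp only at h1 h2
    have e0 : (a ^ 2 + b ^ 2) * (x 0 - y 0) = 0 := by linear_combination a * h1 - b * h2
    have e1 : (a ^ 2 + b ^ 2) * (x 1 - y 1) = 0 := by linear_combination b * h1 + a * h2
    have e0' := (mul_eq_zero.1 e0).resolve_left hab.ne'
    have e1' := (mul_eq_zero.1 e1).resolve_left hab.ne'
    ext i; fin_cases i
    · simp; linarith
    · simp; linarith
  · intro x hx
    have := hf x hx
    rw [hfe] at this hu
    simp only
    linarith

lemma IsView.on_line {z : Plane} {Φ Ψ : Plane → ℝ} (hv : IsView z Φ Ψ) {c : ℝ} {X Y W : Plane}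
    (hX : Ψ X = c * Φ X) (hY : Ψ Y = c * Φ Y) (hW : Ψ W = c * Φ W)
    (h1 : Φ X ≤ Φ Y) (h2 : Φ Y ≤ Φ W) : Y ∈ segment ℝ X W := by
  rcases eq_or_lt_of_le (h1.trans h2) with h | h
  · have : Y = X := hv.inj _ _ (by linarith) (by rw [hX, hY]; congr 1; linarith)
    rw [this]; exact left_mem_segment ℝ X W
  · have hd : 0 < Φ W - Φ X := by linarith
    have hsum : (Φ W - Φ Y) / (Φ W - Φ X) + (Φ Y - Φ X) / (Φ W - Φ X) = 1 := by
      field_simp; ring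
    refine ⟨(Φ W - Φ Y) / (Φ W - Φ X), (Φ Y - Φ X) / (Φ W - Φ X),
      div_nonneg (by linarith) hd.le, div_nonneg (by linarith) hd.le, hsum, ?_⟩
    apply hv.inj
    · rw [hv.aff1 _ _ _ _ hsum]; field_simp; ring
    · rw [hv.aff2 _ _ _ _ hsum, hX, hY, hW]; field_simp; ring

/-- A segment point on the line of slope `c`. -/
lemma IsView.ivt {z : Plane} {Φ Ψ : Plane → ℝ} (hv : IsView z Φ Ψ) {c : ℝ} {X Y : Plane}
    (hX : Ψ X ≤ c * Φ X) (hY : c * Φ Y ≤ Ψ Y) :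
    ∃ n ∈ segment ℝ X Y, Ψ n = c * Φ n := by
  rcases eq_or_lt_of_le (show 0 ≤ (c * Φ X - Ψ X) + (Ψ Y - c * Φ Y) by linarith) with h | h
  · exact ⟨X, left_mem_segment ℝ X Y, by linarith⟩
  · set d := (c * Φ X - Ψ X) + (Ψ Y - c * Φ Y) with hd
    have hsum : (Ψ Y - c * Φ Y) / d + (c * Φ X - Ψ X) / d = 1 := by
      field_simp; rw [hd]; ring
    refine ⟨_, ⟨(Ψ Y - c * Φ Y) / d, (c * Φ X - Ψ X) / d, div_nonneg (by linarith) h.le,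
      div_nonneg (by linarith) h.le, hsum, rfl⟩, ?_⟩
    rw [hv.aff1 _ _ _ _ hsum, hv.aff2 _ _ _ _ hsum]
    field_simp; ring

lemma IsView.union {z : Plane} {Φ Ψ : Plane → ℝ} (hv : IsView z Φ Ψ) {c : ℝ} {n b : Plane}
    {K L : Set Plane} (hK : Convex ℝ K) (hL : Convex ℝ L) (hzK : z ∈ K) (hnK : n ∈ K)
    (hnL : n ∈ L) (hbL : b ∈ L) (hn : Ψ n = c * Φ n) (hb : Ψ b = c * Φ b)
    (hb0 : 0 ≤ Φ b) : segment ℝ z b ⊆ K ∪ L := by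
  rintro x ⟨α, β, hα, hβ, hαβ, rfl⟩
  have e1 := hv.aff1 z b α β hαβ
  have e2 := hv.aff2 z b α β hαβ
  set x := α • z + β • b
  rw [hv.z1] at e1
  rw [hv.z2] at e2
  have hx : Ψ x = c * Φ x := by rw [e1, e2, hb]; ring
  have hx0 : 0 ≤ Φ x := by rw [e1]; nlinarith [mul_nonneg hβ hb0]
  have hxb : Φ x ≤ Φ b := by rw [e1]; nlinarith [mul_nonneg hα hb0]
  rcases le_total (Φ x) (Φ n) with h | h
  · left
    exact hK.segment_subset hzK hnK
      (hv.on_line (c := c) (by rw [hv.z1, hv.z2]; ring) hx hn (by rw [hv.z1]; exact hx0) h)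
  · right
    exact hL.segment_subset hnL hbL (hv.on_line hn hx hb h hxb)

/-- Points behind `L`. -/
lemma IsView.behind {z : Plane} {Φ Ψ : Plane → ℝ} (hv : IsView z Φ Ψ) {u p : Plane}
    (hu : u ∈ segment ℝ z p) (hu0 : 0 < Φ u) :
    0 < Φ p ∧ Φ u ≤ Φ p ∧ Ψ u = Ψ p / Φ p * Φ u := by
  obtain ⟨α, β, hα, hβ, hαβ, rfl⟩ := hu
  have e1 := hv.aff1 z p α β hαβ
  have e2 := hv.aff2 z p α β hαβ
  rw [hv.z1] at e1
  rw [hv.z2] at e2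
  rw [e1] at hu0
  have hp : 0 < Φ p := by
    by_contra hcon
    nlinarith
  refine ⟨hp, ?_, ?_⟩
  · rw [e1]; nlinarith
  · rw [e1, e2]; field_simp; ring

lemma IsView.slope_ne {z : Plane} {Φ Ψ : Plane → ℝ} (hv : IsView z Φ Ψ) {L : Set Plane}
    (hL : Convex ℝ L) (hpos : ∀ x ∈ L, 0 < Φ x) {p p' u y : Plane}
    (hp : p ∉ L) (hu : u ∈ segment ℝ z p) (huL : u ∈ L)
    (hp'0 : 0 < Φ p') (hy : y ∈ segment ℝ p p') (hyL : y ∈ L) (hle : Φ p ≤ Φ p') :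
    Ψ p / Φ p ≠ Ψ p' / Φ p' := by
  intro he
  obtain ⟨hp0, hup, hus⟩ := hv.behind hu (hpos u huL)
  set c := Ψ p / Φ p with hc
  have hps : Ψ p = c * Φ p := by rw [hc]; field_simp
  have hps' : Ψ p' = c * Φ p' := by rw [he]; field_simp
  apply hp
  obtain ⟨α, β, hα, hβ, hαβ, rfl⟩ := hy
  have e1 := hv.aff1 p p' α β hαβ
  have e2 := hv.aff2 p p' α β hαβ
  refine hL.segment_subset huL hyL (hv.on_line hus hps (?_ : _ = c * _) hup ?_)
  · rw [e1, e2, hps, hps']; ring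
  · rw [e1]
    have : α = 1 - β := by linarith
    subst this
    nlinarith

lemma IsView.between {z : Plane} {Φ Ψ : Plane → ℝ} (hv : IsView z Φ Ψ) {K B : Set Plane}
    (hK : Convex ℝ K) (hpos : ∀ x ∈ convexHull ℝ B, 0 < Φ x)
    (hz : z ∈ K) {p p' u u' y : Plane} (hpK : p ∈ K) (hpK' : p' ∈ K)
    (hp : p ∉ convexHull ℝ B) (hp' : p' ∉ convexHull ℝ B)
    (hu : u ∈ segment ℝ z p) (huL : u ∈ convexHull ℝ B)
    (hu' : u' ∈ segment ℝ z p') (huL' : u' ∈ convexHull ℝ B)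
    (hy : y ∈ segment ℝ p p') (hyL : y ∈ convexHull ℝ B)
    (hlt : Ψ p / Φ p < Ψ p' / Φ p') :
    ∃ b ∈ B, Ψ p / Φ p < Ψ b / Φ b ∧ Ψ b / Φ b < Ψ p' / Φ p' ∧
      segment ℝ z b ⊆ K ∪ convexHull ℝ B := by
  have hL : Convex ℝ (convexHull ℝ B) := convex_convexHull ℝ B
  obtain ⟨hp0, hup, hus⟩ := hv.behind hu (hpos u huL)
  obtain ⟨hp0', hup', hus'⟩ := hv.behind hu' (hpos u' huL')
  set c := Ψ p / Φ p with hc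
  set c' := Ψ p' / Φ p' with hc'
  have hps : Ψ p = c * Φ p := by rw [hc]; field_simp
  have hps' : Ψ p' = c' * Φ p' := by rw [hc']; field_simp
  set h : Plane → ℝ := fun x => (Ψ p' - Ψ p) * Φ x + (-(Φ p' - Φ p)) * Ψ x
    + (-(Φ p * Ψ p' - Φ p' * Ψ p)) with hh
  have haff : AffFun h := hv.aff1.comb hv.aff2 _ _ _
  have hhp : h p = 0 := by simp only [hh]; ring
  have hhp' : h p' = 0 := by simp only [hh]; ring
  have hD : 0 < (c' - c) * (Φ p * Φ p') := mul_pos (by linarith) (mul_pos hp0 hp0')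
  have hy1 : h y = 0 ∧ c * Φ y ≤ Ψ y ∧ Ψ y ≤ c' * Φ y := by
    obtain ⟨α, β, hα, hβ, hαβ, rfl⟩ := hy
    rw [haff _ _ _ _ hαβ, hv.aff1 _ _ _ _ hαβ, hv.aff2 _ _ _ _ hαβ, hhp, hhp', hps, hps']
    refine ⟨by ring, ?_, ?_⟩
    · nlinarith [mul_nonneg hβ (mul_nonneg (sub_pos.2 hlt).le hp0'.le)]
    · nlinarith [mul_nonneg hα (mul_nonneg (sub_pos.2 hlt).le hp0.le)]
  obtain ⟨hhy, hy1, hy2⟩ := hy1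
  have key1 : ∀ v ∈ convexHull ℝ B, 0 ≤ h v → Ψ v = c * Φ v → False := by
    intro v hvL hhv hvs
    refine hp (hL.segment_subset huL hvL (hv.on_line hus hps hvs hup ?_))
    simp only [hh, hvs, hps, hps'] at hhv
    by_contra hcon
    nlinarith [mul_pos (mul_pos (sub_pos.2 hlt) hp0') (sub_pos.2 (not_le.1 hcon))]
  have key2 : ∀ v ∈ convexHull ℝ B, 0 ≤ h v → Ψ v = c' * Φ v → False := by
    intro v hvL hhv hvs
    refine hp' (hL.segment_subset huL' hvL (hv.on_line hus' hps' hvs hup' ?_))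
    simp only [hh, hvs, hps, hps'] at hhv
    by_contra hcon
    nlinarith [mul_pos (mul_pos (sub_pos.2 hlt) hp0) (sub_pos.2 (not_le.1 hcon))]
  have hseg : ∀ w ∈ convexHull ℝ B, 0 ≤ h w → ∀ n ∈ segment ℝ w y, 0 ≤ h n := by
    rintro w hw hhw n ⟨α, β, hα, hβ, hαβ, rfl⟩
    rw [haff _ _ _ _ hαβ, hhy]
    nlinarith [mul_nonneg hα hhw]
  obtain ⟨b, hbB, hhb⟩ := haff.exists_ge hyL
  rw [hhy] at hhb
  have hbL : b ∈ convexHull ℝ B := subset_convexHull ℝ B hbB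
  have hb0 := hpos b hbL
  have hb1 : c * Φ b < Ψ b := by
    by_contra hcon
    obtain ⟨n, hn, hns⟩ := hv.ivt (not_lt.1 hcon) hy1
    exact key1 n (hL.segment_subset hbL hyL hn) (hseg b hbL hhb n hn) hns
  have hb2 : Ψ b < c' * Φ b := by
    by_contra hcon
    obtain ⟨n, hn, hns⟩ := hv.ivt hy2 (not_lt.1 hcon)
    rw [segment_symm] at hn
    exact key2 n (hL.segment_subset hbL hyL hn) (hseg b hbL hhb n hn) hns
  have hb1' : c < Ψ b / Φ b := by rwa [lt_div_iff₀ hb0]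
  have hb2' : Ψ b / Φ b < c' := by rwa [div_lt_iff₀ hb0]
  refine ⟨b, hbB, hb1', hb2', ?_⟩
  have hu0 := hpos u huL
  have hu0' := hpos u' huL'
  obtain ⟨n, hn, hns⟩ := hv.ivt (c := Ψ b / Φ b) (X := u) (Y := u')
    (by rw [hus]; nlinarith) (by rw [hus']; nlinarith)
  exact hv.union hK hL hz
    (hK.segment_subset (hK.segment_subset hz hpK hu) (hK.segment_subset hz hpK' hu') hn)
    (hL.segment_subset huL huL' hn) hbL hns (by field_simp) hb0.le

/-- Counting from a point of `K` outside `L`. -/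
lemma count_one {z : Plane} {K B : Set Plane} (hK : Convex ℝ K) (hB : B.Finite)
    (hBne : B.Nonempty) (hz : z ∈ K) (hzL : z ∉ convexHull ℝ B) (S : Finset Plane)
    (hSK : ∀ p ∈ S, p ∈ K ∧ p ∉ convexHull ℝ B)
    (hSz : ∀ p ∈ S, (segment ℝ z p ∩ convexHull ℝ B).Nonempty)
    (hSS : ∀ p ∈ S, ∀ q ∈ S, p ≠ q → (segment ℝ p q ∩ convexHull ℝ B).Nonempty) :
    S.card ≤ {b ∈ B | segment ℝ z b ⊆ K ∪ convexHull ℝ B}.ncard + 1 ∧ S.card ≤ B.ncard := by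
  classical
  have hL : Convex ℝ (convexHull ℝ B) := convex_convexHull ℝ B
  obtain ⟨Φ, Ψ, hv, hpos⟩ := exists_view hL (hB.isCompact_convexHull ℝ).isClosed
    (hBne.convexHull) hzL
  set s : Plane → ℝ := fun x => Ψ x / Φ x with hs
  have hS0 : ∀ p ∈ S, 0 < Φ p := by
    intro p hp
    obtain ⟨u, hu, huL⟩ := hSz p hp
    exact (hv.behind hu (hpos u huL)).1
  have hinj : Set.InjOn s S := by
    intro p hp q hq hpq
    by_contra hne
    rcases le_total (Φ p) (Φ q) with h | h
    · obtain ⟨u, hu, huL⟩ := hSz p hp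
      obtain ⟨y, hy, hyL⟩ := hSS p hp q hq hne
      exact hv.slope_ne hL hpos (hSK p hp).2 hu huL (hS0 q hq) hy hyL h hpq
    · obtain ⟨u, hu, huL⟩ := hSz q hq
      obtain ⟨y, hy, hyL⟩ := hSS q hq p hp (Ne.symm hne)
      exact hv.slope_ne hL hpos (hSK q hq).2 hu huL (hS0 p hp) hy hyL h hpq.symm
  have hbet : ∀ p ∈ S, ∀ q ∈ S, s p < s q → ∃ b ∈ B, s p < s b ∧ s b < s q ∧
      segment ℝ z b ⊆ K ∪ convexHull ℝ B := by
    intro p hp q hq hpq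
    obtain ⟨u, hu, huL⟩ := hSz p hp
    obtain ⟨u', hu', huL'⟩ := hSz q hq
    obtain ⟨y, hy, hyL⟩ := hSS p hp q hq (by rintro rfl; exact lt_irrefl _ hpq)
    exact hv.between hK hpos hz (hSK p hp).1 (hSK q hq).1 (hSK p hp).2 (hSK q hq).2
      hu huL hu' huL' hy hyL hpq
  have hcard : (S.image s).card = S.card := Finset.card_image_of_injOn hinj
  have main : ∀ T : Set Plane, T ⊆ B → (∀ p ∈ S, ∀ q ∈ S, s p < s q →
      ∃ b ∈ T, s p < s b ∧ s b < s q) → S.card ≤ T.ncard + 1 := by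
    intro T hT h
    have hTf : T.Finite := hB.subset hT
    rw [← hcard, Set.ncard_eq_toFinset_card T hTf]
    refine (Finset.card_le_of_interleaved (t := hTf.toFinset.image s) ?_).trans
      (Nat.add_le_add_right Finset.card_image_le 1)
    intro x hx y hy hxy _
    obtain ⟨p, hp, rfl⟩ := Finset.mem_image.1 hx
    obtain ⟨q, hq, rfl⟩ := Finset.mem_image.1 hy
    obtain ⟨b, hb, h1, h2⟩ := h p hp q hq hxy
    exact ⟨s b, Finset.mem_image_of_mem s (hTf.mem_toFinset.2 hb), h1, h2⟩
  constructor
  · refine main _ (Set.sep_subset _ _) ?_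
    intro p hp q hq hpq
    obtain ⟨b, hb, h1, h2, h3⟩ := hbet p hp q hq hpq
    exact ⟨b, ⟨hb, h3⟩, h1, h2⟩
  · rcases S.eq_empty_or_nonempty with rfl | hne
    · simp
    obtain ⟨p0, hp0, hmin⟩ := S.exists_min_image s hne
    obtain ⟨u, hu, huL⟩ := hSz p0 hp0
    obtain ⟨h1, h2, h3⟩ := hv.behind hu (hpos u huL)
    have haff : AffFun (fun x => s p0 * Φ x + (-1) * Ψ x + 0) := hv.aff1.comb hv.aff2 _ _ _
    obtain ⟨b0, hb0, hb0le⟩ := haff.exists_ge huL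
    have hb0s : s b0 ≤ s p0 := by
      have : 0 < Φ b0 := hpos b0 (subset_convexHull ℝ B hb0)
      change Ψ b0 / Φ b0 ≤ _
      rw [div_le_iff₀ this]
      simp only [hs] at hb0le ⊢
      linarith
    have := main (B \ {b0}) Set.sdiff_subset (by
      intro p hp q hq hpq
      obtain ⟨b, hb, h1, h2, h3⟩ := hbet p hp q hq hpq
      refine ⟨b, ⟨hb, ?_⟩, h1, h2⟩
      rintro rfl
      have := hmin p hp
      linarith)
    rwa [Set.ncard_sdiff_singleton_add_one hb0 hB] at this

/-- Counting from a point of `L` outside `K`. -/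
lemma count_two {w : Plane} {A L : Set Plane} (hL : Convex ℝ L) (hA : A.Finite)
    (hAne : A.Nonempty) (hw : w ∈ L) (hwK : w ∉ convexHull ℝ A) (S : Finset Plane)
    (hSA : ∀ p ∈ S, p ∈ A)
    (hSS : ∀ p ∈ S, ∀ q ∈ S, p ≠ q → (segment ℝ p q ∩ L).Nonempty) :
    S.card ≤ {a ∈ A | segment ℝ w a ⊆ L ∪ convexHull ℝ A}.ncard + 2 := by
  classical
  have hK : Convex ℝ (convexHull ℝ A) := convex_convexHull ℝ A
  obtain ⟨Φ, Ψ, hv, hpos⟩ := exists_view hK (hA.isCompact_convexHull ℝ).isClosed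
    (hAne.convexHull) hwK
  rcases S.eq_empty_or_nonempty with rfl | hne
  · simp
  set s : Plane → ℝ := fun x => Ψ x / Φ x with hs
  obtain ⟨p1, hp1, hmin⟩ := S.exists_min_image s hne
  obtain ⟨p3, hp3, hmax⟩ := S.exists_max_image s hne
  have hsub : ((S.erase p1).erase p3 : Set Plane) ⊆
      {a ∈ A | segment ℝ w a ⊆ L ∪ convexHull ℝ A} := by
    intro p2 hp2
    simp only [Finset.coe_erase, Set.mem_sdiff, Finset.mem_coe, Set.mem_singleton_iff] at hp2
    obtain ⟨⟨hp2, h21⟩, h23⟩ := hp2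
    refine ⟨hSA _ hp2, ?_⟩
    have hK1 := subset_convexHull ℝ A (hSA _ hp1)
    have hK2 := subset_convexHull ℝ A (hSA _ hp2)
    have hK3 := subset_convexHull ℝ A (hSA _ hp3)
    have h1 := hpos _ hK1
    have h2 := hpos _ hK2
    have h3 := hpos _ hK3
    obtain ⟨x, hx, hxL⟩ := hSS p1 hp1 p2 hp2 (Ne.symm h21)
    obtain ⟨y, hy, hyL⟩ := hSS p2 hp2 p3 hp3 h23
    have hxK := hK.segment_subset hK1 hK2 hx
    have hyK := hK.segment_subset hK2 hK3 hy
    have e2 : Ψ p2 = s p2 * Φ p2 := by simp only [hs]; field_simp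
    have e1 : Ψ p1 ≤ s p2 * Φ p1 := by
      have := hmin p2 hp2
      rwa [← div_le_iff₀ h1]
    have e3 : s p2 * Φ p3 ≤ Ψ p3 := by
      have := hmax p2 hp2
      rwa [← le_div_iff₀ h3]
    have ex : Ψ x ≤ s p2 * Φ x := by
      obtain ⟨α, β, hα, hβ, hαβ, rfl⟩ := hx
      rw [hv.aff1 _ _ _ _ hαβ, hv.aff2 _ _ _ _ hαβ, e2]
      nlinarith [mul_le_mul_of_nonneg_left e1 hα]
    have ey : s p2 * Φ y ≤ Ψ y := by
      obtain ⟨α, β, hα, hβ, hαβ, rfl⟩ := hy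
      rw [hv.aff1 _ _ _ _ hαβ, hv.aff2 _ _ _ _ hαβ, e2]
      nlinarith [mul_le_mul_of_nonneg_left e3 hβ]
    obtain ⟨n, hn, hns⟩ := hv.ivt ex ey
    exact hv.union hL hK hw (hL.segment_subset hxL hyL hn) (hK.segment_subset hxK hyK hn)
      hK2 hns e2 h2.le
  have h := Set.ncard_le_ncard hsub (hA.subset (Set.sep_subset _ _))
  rw [Set.ncard_coe_finset] at h
  have h' := Finset.pred_card_le_card_erase (s := S.erase p1) (a := p3)
  have h'' := Finset.pred_card_le_card_erase (s := S) (a := p1)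
  omega

/-- Points in different components are separated by `L`. -/
lemma seg_meets {K L : Set Plane} (hK : Convex ℝ K) {x y : Plane} (hx : x ∈ K) (hy : y ∈ K)
    (hne : connectedComponentIn (K \ L) x ≠ connectedComponentIn (K \ L) y) :
    (segment ℝ x y ∩ L).Nonempty := by
  by_contra hcon
  apply hne
  have hsub : segment ℝ x y ⊆ K \ L := fun w hw =>
    ⟨hK.segment_subset hx hy hw, fun hwL => hcon ⟨w, hw, hwL⟩⟩
  have := (convex_segment (𝕜 := ℝ) x y).isPreconnected.subset_connectedComponentIn
    (left_mem_segment ℝ x y) hsub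
  exact connectedComponentIn_eq (this (right_mem_segment ℝ x y))

/-- Each petal contains a vertex. -/
lemma petal_vertex {A L : Set Plane} (hL : Convex ℝ L) (hc : IsClosed L) (hne : L.Nonempty)
    {p : Plane} (hp : p ∈ convexHull ℝ A \ L) :
    ∃ a ∈ A, a ∉ L ∧ connectedComponentIn (convexHull ℝ A \ L) a =
      connectedComponentIn (convexHull ℝ A \ L) p := by
  obtain ⟨Φ, Ψ, hv, hpos⟩ := exists_view hL hc hne hp.2
  have haff : AffFun (fun x => (-1) * Φ x + 0 * Ψ x + 0) := hv.aff1.comb hv.aff2 _ _ _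
  obtain ⟨a, ha, hle⟩ := haff.exists_ge hp.1
  have hleB : Φ a ≤ 0 := by
    simp only [hv.z1] at hle
    linarith
  refine ⟨a, ha, fun haL => by linarith [hpos a haL], ?_⟩
  by_contra hcon
  obtain ⟨x, hx, hxL⟩ := seg_meets (convex_convexHull ℝ A) (subset_convexHull ℝ A ha) hp.1 hcon
  obtain ⟨α, β, hα, hβ, hαβ, rfl⟩ := hx
  have := hpos _ hxL
  rw [hv.aff1 _ _ _ _ hαβ, hv.z1] at this
  nlinarith [mul_nonneg hα (neg_nonneg.2 hleB)]

/-- The frontier of the hull of a finite planar set is covered by segments. -/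
lemma mem_frontier_hull {A : Set Plane} {x : Plane} (hA : A.Finite)
    (hx : x ∈ frontier (convexHull ℝ A)) :
    ∃ a ∈ A, ∃ b ∈ A, x ∈ segment ℝ a b := by
  have hxK : x ∈ convexHull ℝ A := (hA.isCompact_convexHull ℝ).isClosed.frontier_subset hx
  obtain ⟨ι, _, z, w, hzA, hind, hw0, hw1, hwx⟩ := eq_pos_convex_span_of_mem_convexHull hxK
  have hcard := hind.card_le_finrank_succ
  have hrank : Module.finrank ℝ Plane = 2 := by simp
  have hle : Module.finrank ℝ (vectorSpan ℝ (Set.range z)) ≤ Module.finrank ℝ Plane :=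
    Submodule.finrank_le _
  rw [hrank] at hle
  have hne3 : Fintype.card ι ≠ 3 := by
    intro h3
    have htop : affineSpan ℝ (Set.range z) = ⊤ :=
      hind.affineSpan_eq_top_iff_card_eq_finrank_add_one.2 (by rw [h3, hrank])
    let b : AffineBasis ι ℝ Plane := ⟨z, hind, htop⟩
    have hxi : x ∈ interior (convexHull ℝ (Set.range b)) := by
      rw [b.interior_convexHull]
      intro i
      have hx' : x = Finset.univ.affineCombination ℝ b w := by
        rw [Finset.affineCombination_eq_linear_combination _ _ _ hw1]
        exact hwx.symm
      rw [hx', b.coord_apply_combination_of_mem (Finset.mem_univ i) hw1]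
      exact hw0 i
    exact hx.2 (interior_mono (convexHull_mono hzA) hxi)
  have hne0 : Fintype.card ι ≠ 0 := by
    intro h0
    have := Fintype.card_eq_zero_iff.1 h0
    simp at hw1
  have h12 : Fintype.card ι = 1 ∨ Fintype.card ι = 2 := by omega
  rcases h12 with h | h
  · obtain ⟨e⟩ := Fintype.card_eq.1 (h.trans (Fintype.card_fin 1).symm)
    rw [← e.symm.sum_comp] at hw1 hwx
    simp only [Fin.sum_univ_one] at hw1 hwx
    refine ⟨_, hzA ⟨e.symm 0, rfl⟩, _, hzA ⟨e.symm 0, rfl⟩, ?_⟩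
    rw [← hwx, hw1, one_smul]
    exact left_mem_segment ℝ _ _
  · obtain ⟨e⟩ := Fintype.card_eq.1 (h.trans (Fintype.card_fin 2).symm)
    rw [← e.symm.sum_comp] at hw1 hwx
    simp only [Fin.sum_univ_two] at hw1 hwx
    exact ⟨_, hzA ⟨e.symm 0, rfl⟩, _, hzA ⟨e.symm 1, rfl⟩,
      _, _, (hw0 _).le, (hw0 _).le, hw1, hwx⟩

lemma hull_disjoint {V : Type} [Fintype V] {G : SimpleGraph V} {f : V → Plane} {C : Set Plane}
    (hrep : IsOutsideObstacleRep G f C) {Z : Set V} (hZ : Z.Pairwise G.Adj) :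
    Disjoint (convexHull ℝ (f '' Z)) C := by
  rw [Set.disjoint_left]
  intro p hpK hpC
  obtain ⟨⟨hinj, _, _, _, hdis, _⟩, hout⟩ := hrep
  obtain ⟨hpE, hunb⟩ := hout hpC
  have hfin : (f '' Z).Finite := Set.toFinite _
  set Q := connectedComponentIn (edgeUnion G f)ᶜ p with hQ
  have hpQ : p ∈ Q := mem_connectedComponentIn hpE
  have hQsub : Q ⊆ (edgeUnion G f)ᶜ := connectedComponentIn_subset _ _
  have hfr : (Q ∩ frontier (convexHull ℝ (f '' Z))).Nonempty := by
    by_contra hcon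
    have hKcl := hfin.isClosed_convexHull ℝ
    have hint : ∀ x ∈ Q, x ∈ convexHull ℝ (f '' Z) → x ∈ interior (convexHull ℝ (f '' Z)) := by
      intro x hxQ hxK
      by_contra hxi
      exact hcon ⟨x, hxQ, by rw [hKcl.frontier_eq]; exact ⟨hxK, hxi⟩⟩
    obtain ⟨y, hyQ, hyK⟩ : ∃ y ∈ Q, y ∉ convexHull ℝ (f '' Z) := by
      by_contra! hall
      exact hunb ((hfin.isCompact_convexHull ℝ).isBounded.subset hall)
    have hpre : IsPreconnected Q := isPreconnected_connectedComponentIn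
    obtain ⟨x, _, hx1, hx2⟩ := hpre (interior (convexHull ℝ (f '' Z)))
      (convexHull ℝ (f '' Z))ᶜ isOpen_interior hKcl.isOpen_compl (by
        intro x hx
        by_cases hxK : x ∈ convexHull ℝ (f '' Z)
        · exact Or.inl (hint x hx hxK)
        · exact Or.inr hxK) ⟨p, hpQ, hint p hpQ hpK⟩ ⟨y, hyQ, hyK⟩
    exact hx2 (interior_subset hx1)
  obtain ⟨x, hxQ, hxF⟩ := hfr
  have hno : ∀ u v, G.Adj u v → x ∉ segment ℝ (f u) (f v) := by
    intro u v huv hx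
    exact hQsub hxQ (Set.mem_iUnion.2 ⟨u, Set.mem_iUnion.2 ⟨v, Set.mem_iUnion.2 ⟨huv, hx⟩⟩⟩)
  obtain ⟨_, ⟨u, hu, rfl⟩, _, ⟨v, hv, rfl⟩, hxs⟩ := mem_frontier_hull hfin hxF
  by_cases huv : u = v
  · subst huv
    rw [segment_same, Set.mem_singleton_iff] at hxs
    by_cases hs : ∃ w ∈ Z, u ≠ w
    · obtain ⟨w, hw, hne⟩ := hs
      exact hno u w (hZ hu hw hne) (by rw [hxs]; exact left_mem_segment ℝ _ _)
    · push Not at hs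
      have hZu : Z = {u} := Set.eq_singleton_iff_unique_mem.2 ⟨hu, fun w hw => (hs w hw).symm⟩
      rw [hZu, Set.image_singleton, convexHull_singleton, Set.mem_singleton_iff] at hpK
      exact Set.disjoint_left.1 hdis hpC ⟨u, hpK.symm⟩
  · exact hno u v (hZ hu hv huv) hxs

/-- In an outside-obstacle representation, if the convex hulls of two
cliques `Z, Z'` are exactly `t`-crossing, then every vertex of `Z` has at least `t - 1`
neighbors in `Z'` and vice versa. -/
theorem exactlyCrossing_min_neighbors
    {V : Type} [Fintype V] (G : SimpleGraph V) (f : V → Plane) (C : Set Plane)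
    (hrep : IsOutsideObstacleRep G f C) (Z Z' : Set V)
    (hZ : Z.Pairwise G.Adj) (hZ' : Z'.Pairwise G.Adj) (t : ℕ)
    (hcross : ExactlyCrossing (f '' Z) (f '' Z') t) :
    (∀ z ∈ Z, t - 1 ≤ {z' ∈ Z' | G.Adj z z'}.ncard) ∧
    (∀ z' ∈ Z', t - 1 ≤ {z ∈ Z | G.Adj z z'}.ncard) := by
  classical
  obtain ⟨⟨x0, hx0A, hx0B⟩, p, hpS, hpne, -⟩ := hcross
  set A := f '' Z with hA
  set B := f '' Z' with hB
  have hAf : A.Finite := Set.toFinite _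
  have hBf : B.Finite := Set.toFinite _
  have hAne : A.Nonempty := convexHull_nonempty_iff.1 ⟨x0, hx0A⟩
  have hBne : B.Nonempty := convexHull_nonempty_iff.1 ⟨x0, hx0B⟩
  have hdA : Disjoint (convexHull ℝ A) C := hull_disjoint hrep hZ
  have hdB : Disjoint (convexHull ℝ B) C := hull_disjoint hrep hZ'
  have hdU : Disjoint (convexHull ℝ A ∪ convexHull ℝ B) C := hdA.union_left hdB
  have hfinj : Function.Injective f := hrep.1.1
  have hadj : ∀ u v, u ≠ v → segment ℝ (f u) (f v) ⊆ convexHull ℝ A ∪ convexHull ℝ B →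
      G.Adj u v := fun u v huv hs => (hrep.1.2.2.2.2.2 u v huv).2 (hdU.mono_left hs)
  have hKc := convex_convexHull ℝ A
  have hLc := convex_convexHull ℝ B
  have hLcl : IsClosed (convexHull ℝ B) := (hBf.isCompact_convexHull ℝ).isClosed
  have hvert := fun i => petal_vertex hLc hLcl hBne.convexHull (hpS i)
  choose q hqA hqL hqc using hvert
  have hqne : ∀ i j, i ≠ j → connectedComponentIn (convexHull ℝ A \ convexHull ℝ B) (q i) ≠
      connectedComponentIn (convexHull ℝ A \ convexHull ℝ B) (q j) := by
    intro i j hij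
    rw [hqc, hqc]
    exact hpne i j hij
  have hqinj : Function.Injective q := by
    intro i j hij
    by_contra hne
    exact hqne i j hne (by rw [hij])
  have hqK : ∀ i, q i ∈ convexHull ℝ A := fun i => subset_convexHull ℝ A (hqA i)
  have hone : ∀ a ∈ A, a ∉ convexHull ℝ B →
      t ≤ {b ∈ B | segment ℝ a b ⊆ convexHull ℝ A ∪ convexHull ℝ B}.ncard + 1 ∧
      t ≤ B.ncard := by
    intro a ha haL
    have haK := subset_convexHull ℝ A ha
    set I : Finset (Fin (t + 1)) := Finset.univ.filter (fun i =>
      connectedComponentIn (convexHull ℝ A \ convexHull ℝ B) a ≠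
        connectedComponentIn (convexHull ℝ A \ convexHull ℝ B) (q i)) with hI
    have hIcard : t ≤ I.card := by
      have h1 : Iᶜ.card ≤ 1 := by
        rw [Finset.card_le_one]
        intro i hi j hj
        simp only [hI, ne_eq, not_not, Finset.mem_compl, Finset.mem_filter, Finset.mem_univ,
          true_and] at hi hj
        by_contra hij
        exact hqne i j hij (hi.symm.trans hj)
      have h2 := Finset.card_add_card_compl I
      rw [Fintype.card_fin] at h2
      omega
    have hc : (I.image q).card = I.card := Finset.card_image_of_injective _ hqinj
    have := count_one hKc hBf hBne haK haL (I.image q) (by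
      intro x hx
      obtain ⟨i, _, rfl⟩ := Finset.mem_image.1 hx
      exact ⟨hqK i, hqL i⟩) (by
      intro x hx
      obtain ⟨i, hi, rfl⟩ := Finset.mem_image.1 hx
      exact seg_meets hKc haK (hqK i) (Finset.mem_filter.1 hi).2) (by
      intro x hx y hy hxy
      obtain ⟨i, hi, rfl⟩ := Finset.mem_image.1 hx
      obtain ⟨j, hj, rfl⟩ := Finset.mem_image.1 hy
      exact seg_meets hKc (hqK i) (hqK j) (hqne i j (fun h => hxy (by rw [h]))))
    rw [hc] at this
    exact ⟨hIcard.trans this.1, hIcard.trans this.2⟩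
  constructor
  · intro z hz
    have hzA : f z ∈ A := Set.mem_image_of_mem f hz
    by_cases hzL : f z ∈ convexHull ℝ B
    · have h1 := (hone (q 0) (hqA 0) (hqL 0)).2
      rw [hB, Set.ncard_image_of_injective _ hfinj] at h1
      have hsub : Z' \ {z} ⊆ {z' ∈ Z' | G.Adj z z'} := by
        rintro v ⟨hv, hvz⟩
        refine ⟨hv, hadj z v (fun h => hvz h.symm) ?_⟩
        exact (hLc.segment_subset hzL
          (subset_convexHull ℝ B (Set.mem_image_of_mem f hv))).trans Set.subset_union_right
      have h2 := Set.ncard_le_ncard hsub (Set.toFinite _)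
      have h3 := Set.pred_ncard_le_ncard_sdiff_singleton Z' z
      omega
    · have h1 := (hone (f z) hzA hzL).1
      have hsub : {b ∈ B | segment ℝ (f z) b ⊆ convexHull ℝ A ∪ convexHull ℝ B} ⊆
          f '' {z' ∈ Z' | G.Adj z z'} := by
        rintro b ⟨hb, hseg⟩
        obtain ⟨v, hv, rfl⟩ := hb
        refine ⟨v, ⟨hv, hadj z v ?_ hseg⟩, rfl⟩
        rintro rfl
        exact hzL (subset_convexHull ℝ B (Set.mem_image_of_mem f hv))
      have h2 := Set.ncard_le_ncard hsub (Set.toFinite _)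
      rw [Set.ncard_image_of_injective _ hfinj] at h2
      omega
  · intro w hw
    have hwL : f w ∈ convexHull ℝ B := subset_convexHull ℝ B (Set.mem_image_of_mem f hw)
    have hScard : (Finset.univ.image q).card = t + 1 := by
      rw [Finset.card_image_of_injective _ hqinj, Finset.card_univ, Fintype.card_fin]
    have hSA : ∀ x ∈ Finset.univ.image q, x ∈ A := by
      intro x hx
      obtain ⟨i, _, rfl⟩ := Finset.mem_image.1 hx
      exact hqA i
    by_cases hwK : f w ∈ convexHull ℝ A
    · have hsub0 : ((Finset.univ.image q : Finset Plane) : Set Plane) ⊆ A := fun x hx =>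
        hSA x (Finset.mem_coe.1 hx)
      have h1 := Set.ncard_le_ncard hsub0 hAf
      rw [Set.ncard_coe_finset, hScard, hA, Set.ncard_image_of_injective _ hfinj] at h1
      have hsub : Z \ {w} ⊆ {z ∈ Z | G.Adj z w} := by
        rintro v ⟨hv, hvz⟩
        refine ⟨hv, hadj v w hvz ?_⟩
        exact (hKc.segment_subset
          (subset_convexHull ℝ A (Set.mem_image_of_mem f hv)) hwK).trans Set.subset_union_left
      have h2 := Set.ncard_le_ncard hsub (Set.toFinite _)
      have h3 := Set.pred_ncard_le_ncard_sdiff_singleton Z w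
      omega
    · have h1 := count_two hLc hAf hAne hwL hwK (Finset.univ.image q) hSA (by
        intro x hx y hy hxy
        obtain ⟨i, hi, rfl⟩ := Finset.mem_image.1 hx
        obtain ⟨j, hj, rfl⟩ := Finset.mem_image.1 hy
        exact seg_meets hKc (hqK i) (hqK j) (hqne i j (fun h => hxy (by rw [h]))))
      rw [hScard] at h1
      have hsub : {a ∈ A | segment ℝ (f w) a ⊆ convexHull ℝ B ∪ convexHull ℝ A} ⊆
          f '' {z ∈ Z | G.Adj z w} := by
        rintro b ⟨hb, hseg⟩
        obtain ⟨v, hv, rfl⟩ := hb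
        refine ⟨v, ⟨hv, (hadj w v ?_ (by rwa [Set.union_comm] at hseg)).symm⟩, rfl⟩
        rintro rfl
        exact hwK (subset_convexHull ℝ A (Set.mem_image_of_mem f hv))
      have h2 := Set.ncard_le_ncard hsub (Set.toFinite _)
      rw [Set.ncard_image_of_injective _ hfinj] at h2
      omega

end
end
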